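/- arXiv:math/0507036 — 5 statements merged into one kernel-verified Lean document; each statement's English description precedes it below -/
import Mathlib

section
/- For every 0 ≤ q ≤ n, the endomorphism Λ^q V of the q-th exterior power Λ^q M is injective and satisfies (Λ^q V)^n = p^q·id; there exists a unique Z_p-linear endomorphism F_q of Λ^q M with F_q ∘ Λ^q V = p·id, this F_q also satisfies (Λ^q V) ∘ F_q = p·id (so that Λ^q M, with the operators F_q and Λ^q V, is an R-module), and F_1 = F. -/
set_option synthInstance.maxHeartbeats 1000000
set_option maxHeartbeats 1000000

/-! Statement 2: for `0 ≤ q ≤ n`, `Λ^q V` is injective, `(Λ^q V)^n = p^q·id`, there is a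
unique endomorphism `F_q` of `Λ^q M` with `F_q ∘ Λ^q V = p·id`; it also satisfies
`Λ^q V ∘ F_q = p·id` (so `Λ^q M` is an `R`-module), and `F₁ = F` (under `Λ^1 M ≅ M`). -/

noncomputable section

/-- The Verschiebung operator `V` on `M = ℤ_p^n`, determined by
`V a₀ = p·a_{n-1}` and `V aᵢ = a_{i-1}` for `i ≥ 1`. -/
def Vmap (p n : ℕ) [Fact p.Prime] : Module.End ℤ_[p] (Fin n → ℤ_[p]) :=
  LinearMap.pi fun j =>
    if h : (j : ℕ) + 1 < n then LinearMap.proj (⟨(j : ℕ) + 1, h⟩ : Fin n)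
    else (p : ℤ_[p]) • LinearMap.proj (⟨0, j.pos⟩ : Fin n)

/-- The Frobenius operator `F` on `M = ℤ_p^n`, determined by
`F aᵢ = p·a_{i+1}` for `i ≤ n-2` and `F a_{n-1} = a₀`. -/
def Fmap (p n : ℕ) [Fact p.Prime] : Module.End ℤ_[p] (Fin n → ℤ_[p]) :=
  LinearMap.pi fun j =>
    if _ : (j : ℕ) = 0 then LinearMap.proj (⟨n - 1, Nat.sub_lt j.pos Nat.one_pos⟩ : Fin n)
    else (p : ℤ_[p]) •
      LinearMap.proj (⟨(j : ℕ) - 1, lt_of_le_of_lt (Nat.sub_le _ _) j.isLt⟩ : Fin n)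

/-- The endomorphism `Λ^q f` of the `q`-th exterior power (a submodule of the
exterior algebra) induced by an endomorphism `f` of `M`. -/
def extPowMap {R : Type} [CommRing R] {M : Type} [AddCommGroup M] [Module R M]
    (q : ℕ) (f : M →ₗ[R] M) : Module.End R (⋀[R]^q M) :=
  (ExteriorAlgebra.map f).toLinearMap.restrict (p := ⋀[R]^q M) (q := ⋀[R]^q M)
    (fun x hx => by
      have h2 : Submodule.map (ExteriorAlgebra.map f).toLinearMap
          (LinearMap.range (ExteriorAlgebra.ι R (M := M))) ≤
          LinearMap.range (ExteriorAlgebra.ι R (M := M)) := by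
        rw [ExteriorAlgebra.ι_range_map_map]
        exact LinearMap.map_le_range
      have h1 : Submodule.map (ExteriorAlgebra.map f).toLinearMap (⋀[R]^q M) ≤ ⋀[R]^q M := by
        rw [ExteriorAlgebra.exteriorPower, Submodule.map_pow]
        exact pow_le_pow_left' h2 q
      exact h1 (Submodule.mem_map_of_mem hx))

theorem Vmap_apply (p n : ℕ) [Fact p.Prime] (x : Fin n → ℤ_[p]) (j : Fin n) :
    Vmap p n x j = if h : (j : ℕ) + 1 < n then x ⟨(j : ℕ) + 1, h⟩
      else (p : ℤ_[p]) * x ⟨0, j.pos⟩ := by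
  simp only [Vmap, LinearMap.pi_apply]
  split_ifs <;> simp

theorem Fmap_apply (p n : ℕ) [Fact p.Prime] (x : Fin n → ℤ_[p]) (j : Fin n) :
    Fmap p n x j = if _ : (j : ℕ) = 0 then x ⟨n - 1, Nat.sub_lt j.pos Nat.one_pos⟩
      else (p : ℤ_[p]) * x ⟨(j : ℕ) - 1, lt_of_le_of_lt (Nat.sub_le _ _) j.isLt⟩ := by
  simp only [Fmap, LinearMap.pi_apply]
  split_ifs <;> simp

theorem Vmap_pow_apply (p n : ℕ) [Fact p.Prime] (k : ℕ) (hk : k ≤ n) (x : Fin n → ℤ_[p])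
    (j : Fin n) :
    (Vmap p n ^ k) x j = if h : (j : ℕ) + k < n then x ⟨(j : ℕ) + k, h⟩
      else (p : ℤ_[p]) * x ⟨(j : ℕ) + k - n, by omega⟩ := by
  induction k generalizing x with
  | zero => simp
  | succ k ih =>
    rw [pow_succ, Module.End.mul_apply, ih (by omega)]
    have hj := j.isLt
    by_cases h1 : (j : ℕ) + k < n
    · by_cases h2 : (j : ℕ) + (k + 1) < n
      · rw [dif_pos h1, dif_pos h2, Vmap_apply, dif_pos (by simpa [add_assoc] using h2)]
        congr 1
      · rw [dif_pos h1, dif_neg h2, Vmap_apply, dif_neg (by simpa [add_assoc] using h2)]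
        congr 3
        omega
    · rw [dif_neg h1, dif_neg (by omega), Vmap_apply, dif_pos (by simp only; omega)]
      congr 3
      simp only
      omega

theorem Vmap_pow (p n : ℕ) [Fact p.Prime] :
    Vmap p n ^ n = (p : ℤ_[p]) • (1 : Module.End ℤ_[p] (Fin n → ℤ_[p])) := by
  apply LinearMap.ext
  intro x
  funext j
  rw [Vmap_pow_apply p n n le_rfl, dif_neg (by omega)]
  simp

theorem Fmap_mul_Vmap (p n : ℕ) [Fact p.Prime] :
    Fmap p n * Vmap p n = (p : ℤ_[p]) • (1 : Module.End ℤ_[p] (Fin n → ℤ_[p])) := by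
  apply LinearMap.ext
  intro x
  funext j
  have hj := j.isLt
  rw [Module.End.mul_apply, Fmap_apply]
  by_cases h : (j : ℕ) = 0
  · rw [dif_pos h, Vmap_apply, dif_neg (by simp only; omega)]
    simp only [LinearMap.smul_apply, Module.End.one_apply, Pi.smul_apply, smul_eq_mul]
    congr 2
    exact Fin.ext h.symm
  · rw [dif_neg h, Vmap_apply, dif_pos (by simp only; omega)]
    simp only [LinearMap.smul_apply, Module.End.one_apply, Pi.smul_apply, smul_eq_mul]
    congr 2
    apply Fin.ext
    simp only
    omega

section
variable {R : Type} [CommRing R] {M : Type} [AddCommGroup M] [Module R M]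

theorem extPowMap_eq (q : ℕ) (f : M →ₗ[R] M) : extPowMap q f = exteriorPower.map q f := by
  apply exteriorPower.linearMap_ext
  ext m
  rw [LinearMap.compAlternatingMap_apply, LinearMap.compAlternatingMap_apply,
    exteriorPower.map_apply_ιMulti]
  simp only [extPowMap, LinearMap.coe_restrict_apply, exteriorPower.ιMulti_apply_coe]
  exact ExteriorAlgebra.map_apply_ιMulti f m

theorem extPowMap_mul (q : ℕ) (f g : Module.End R M) :
    extPowMap q (f * g) = extPowMap q f * extPowMap q g := by
  simp only [extPowMap_eq]
  exact exteriorPower.map_comp g f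

theorem extPowMap_one (q : ℕ) : extPowMap q (1 : Module.End R M) = 1 := by
  simp only [extPowMap_eq]
  exact exteriorPower.map_id

theorem extPowMap_pow (q k : ℕ) (f : Module.End R M) :
    extPowMap q (f ^ k) = extPowMap q f ^ k := by
  induction k with
  | zero => simp [extPowMap_one]
  | succ k ih => rw [pow_succ, pow_succ, extPowMap_mul, ih]

theorem extPowMap_smul_one (q : ℕ) (c : R) :
    extPowMap q (c • (1 : Module.End R M)) = c ^ q • (1 : Module.End R (⋀[R]^q M)) := by
  rw [extPowMap_eq]
  apply exteriorPower.linearMap_ext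
  apply AlternatingMap.ext
  intro m
  rw [LinearMap.compAlternatingMap_apply, LinearMap.compAlternatingMap_apply,
    exteriorPower.map_apply_ιMulti]
  have := (exteriorPower.ιMulti R q (M := M)).map_smul_univ (fun _ => c) m
  simpa [Function.comp_def] using this
end

theorem Vmap_single (p n : ℕ) [Fact p.Prime] (j : Fin n) :
    Vmap p n (Pi.single (if h : (j : ℕ) + 1 < n then ⟨(j : ℕ) + 1, h⟩ else ⟨0, j.pos⟩) 1) =
      (if (j : ℕ) + 1 < n then (1 : ℤ_[p]) else (p : ℤ_[p])) •
        (Pi.single j 1 : Fin n → ℤ_[p]) := by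
  funext i
  have hi := i.isLt
  have hj := j.isLt
  rw [Vmap_apply]
  by_cases h1 : (i : ℕ) + 1 < n <;> by_cases h2 : (j : ℕ) + 1 < n <;>
    simp only [h1, h2, dif_pos, dif_neg, if_true, if_false, not_false_eq_true, Pi.smul_apply,
      Pi.single_apply, Fin.ext_iff, smul_eq_mul, Fin.val_mk]
  · simp
  · rw [if_neg (by omega), if_neg (by omega)]
    simp
  · rw [if_neg (by omega), if_neg (by omega)]
    simp
  · rw [if_pos (by omega)]

theorem smul_mem_range (p n q : ℕ) [Fact p.Prime] (x : ⋀[ℤ_[p]]^q (Fin n → ℤ_[p])) :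
    (p : ℤ_[p]) • x ∈ LinearMap.range (extPowMap q (Vmap p n)) := by
  have hs : Submodule.span ℤ_[p]
      (Set.range (fun i : Fin n => (Pi.single i 1 : Fin n → ℤ_[p]))) = ⊤ := by
    have := (Pi.basisFun ℤ_[p] (Fin n)).span_eq
    rw [← this]
    congr 2
    funext i
    simp
  have hx : x ∈ Submodule.span ℤ_[p] (exteriorPower.ιMulti ℤ_[p] q ''
      {a | Set.range a ⊆ Set.range (fun i : Fin n => (Pi.single i 1 : Fin n → ℤ_[p]))}) := by
    rw [exteriorPower.ιMulti_span_of_span _ _ _ hs]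
    trivial
  induction hx using Submodule.span_induction with
  | zero => simp
  | add x y _ _ hx hy => rw [smul_add]; exact add_mem hx hy
  | smul c x _ hx => rw [smul_comm]; exact Submodule.smul_mem _ _ hx
  | mem x hx =>
    obtain ⟨a, ha, rfl⟩ := hx
    have ha' : ∀ k, ∃ i : Fin n, (Pi.single i 1 : Fin n → ℤ_[p]) = a k :=
      fun k => ha (Set.mem_range_self k)
    choose i hi using ha'
    by_cases hinj : Function.Injective i
    · set c : Fin q → ℤ_[p] :=
        fun k => if (i k : ℕ) + 1 < n then (1 : ℤ_[p]) else (p : ℤ_[p]) with hc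
      have hdvd : ∏ k, c k ∣ (p : ℤ_[p]) := by
        by_cases h : ∃ k0, ¬ ((i k0 : ℕ) + 1 < n)
        · obtain ⟨k0, hk0⟩ := h
          rw [Finset.prod_eq_single k0]
          · simp [hc, hk0]
          · intro k _ hk
            have : i k ≠ i k0 := fun e => hk (hinj e)
            have h3 : (i k : ℕ) ≠ i k0 := fun e => this (Fin.ext e)
            have := (i k).isLt
            have := (i k0).isLt
            exact if_pos (by omega)
          · simp
        · push Not at h
          rw [Finset.prod_eq_one]
          · exact one_dvd _
          · intro k _
            exact if_pos (h k)
      obtain ⟨d, hd⟩ := hdvd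
      refine ⟨d • exteriorPower.ιMulti ℤ_[p] q (fun k => Pi.single
        (if h : (i k : ℕ) + 1 < n then ⟨(i k : ℕ) + 1, h⟩ else ⟨0, (i k).pos⟩) 1), ?_⟩
      rw [map_smul, extPowMap_eq, exteriorPower.map_apply_ιMulti]
      have h1 : (⇑(Vmap p n) ∘ fun k => (Pi.single
          (if h : (i k : ℕ) + 1 < n then ⟨(i k : ℕ) + 1, h⟩ else ⟨0, (i k).pos⟩) 1 :
            Fin n → ℤ_[p])) = fun k => c k • a k := by
        funext k
        rw [Function.comp_apply, Vmap_single, hi]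
      rw [h1, AlternatingMap.map_smul_univ, smul_smul, mul_comm, ← hd]
    · have : ¬ Function.Injective a := by
        intro h
        apply hinj
        intro k l hkl
        apply h
        rw [← hi, ← hi, hkl]
      rw [AlternatingMap.map_eq_zero_of_not_injective _ _ this, smul_zero]
      exact zero_mem _

theorem extPow_pow (p n q : ℕ) [Fact p.Prime] :
    extPowMap q (Vmap p n) ^ n =
      ((p : ℤ_[p]) ^ q) • (1 : Module.End ℤ_[p] (⋀[ℤ_[p]]^q (Fin n → ℤ_[p]))) := by
  rw [← extPowMap_pow, Vmap_pow, extPowMap_smul_one]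

theorem ppow_ne (p q : ℕ) [Fact p.Prime] : (p : ℤ_[p]) ^ q ≠ 0 :=
  pow_ne_zero _ (Nat.cast_ne_zero.mpr (Fact.out : p.Prime).ne_zero)

/-- Right cancellation of `Λ^q V`. -/
theorem extPow_cancel (p n q : ℕ) [Fact p.Prime] (hn : 1 ≤ n)
    (A B : Module.End ℤ_[p] (⋀[ℤ_[p]]^q (Fin n → ℤ_[p])))
    (h : A * extPowMap q (Vmap p n) = B * extPowMap q (Vmap p n)) : A = B := by
  have h2 : A * extPowMap q (Vmap p n) ^ n = B * extPowMap q (Vmap p n) ^ n := by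
    obtain ⟨m, rfl⟩ : ∃ m, n = m + 1 := ⟨n - 1, by omega⟩
    rw [pow_succ', ← mul_assoc, ← mul_assoc, h]
  rw [extPow_pow] at h2
  apply LinearMap.ext
  intro x
  have h3 := LinearMap.congr_fun h2 x
  simp only [Module.End.mul_apply, LinearMap.smul_apply, Module.End.one_apply, map_smul] at h3
  exact smul_right_injective _ (ppow_ne p q) h3

theorem extPow_injective (p n q : ℕ) [Fact p.Prime] (hn : 1 ≤ n) :
    Function.Injective (⇑(extPowMap q (Vmap p n))) := by
  intro x y hxy
  obtain ⟨m, hm⟩ : ∃ m, n = m + 1 := ⟨n - 1, by omega⟩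
  have h2 : (extPowMap q (Vmap p n) ^ n) x = (extPowMap q (Vmap p n) ^ n) y := by
    have e : extPowMap q (Vmap p n) ^ n =
      extPowMap q (Vmap p n) ^ m * extPowMap q (Vmap p n) := by rw [← pow_succ, ← hm]
    rw [e, Module.End.mul_apply, Module.End.mul_apply, hxy]
  rw [extPow_pow] at h2
  exact smul_right_injective _ (ppow_ne p q) h2

theorem statement2 (p n q : ℕ) [Fact p.Prime] (hp : Odd p) (hn : 1 ≤ n) (hq : q ≤ n) :
    Function.Injective (⇑(extPowMap q (Vmap p n))) ∧
    extPowMap q (Vmap p n) ^ n =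
      ((p : ℤ_[p]) ^ q) • (1 : Module.End ℤ_[p] (⋀[ℤ_[p]]^q (Fin n → ℤ_[p]))) ∧
    (∃! Fq : Module.End ℤ_[p] (⋀[ℤ_[p]]^q (Fin n → ℤ_[p])),
      Fq * extPowMap q (Vmap p n) =
        (p : ℤ_[p]) • (1 : Module.End ℤ_[p] (⋀[ℤ_[p]]^q (Fin n → ℤ_[p])))) ∧
    (∀ Fq : Module.End ℤ_[p] (⋀[ℤ_[p]]^q (Fin n → ℤ_[p])),
      Fq * extPowMap q (Vmap p n) =
        (p : ℤ_[p]) • (1 : Module.End ℤ_[p] (⋀[ℤ_[p]]^q (Fin n → ℤ_[p]))) →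
      extPowMap q (Vmap p n) * Fq =
        (p : ℤ_[p]) • (1 : Module.End ℤ_[p] (⋀[ℤ_[p]]^q (Fin n → ℤ_[p])))) ∧
    (∀ F1 : Module.End ℤ_[p] (⋀[ℤ_[p]]^1 (Fin n → ℤ_[p])),
      F1 * extPowMap 1 (Vmap p n) =
        (p : ℤ_[p]) • (1 : Module.End ℤ_[p] (⋀[ℤ_[p]]^1 (Fin n → ℤ_[p]))) →
      F1 = extPowMap 1 (Fmap p n)) := by
  have hinj := extPow_injective p n q hn
  refine ⟨hinj, extPow_pow p n q, ?_, ?_, ?_⟩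
  · let e := LinearEquiv.ofInjective (extPowMap q (Vmap p n)) hinj
    refine ⟨e.symm.toLinearMap ∘ₗ LinearMap.codRestrict _ ((p : ℤ_[p]) • LinearMap.id)
      (fun x => smul_mem_range p n q x), ?_, ?_⟩
    · apply LinearMap.ext
      intro x
      apply e.injective
      simp only [Module.End.mul_apply, LinearMap.comp_apply, LinearEquiv.coe_coe,
        LinearEquiv.apply_symm_apply]
      apply Subtype.ext
      rw [LinearMap.codRestrict_apply, LinearEquiv.ofInjective_apply]
      simp
    · intro G hG
      apply extPow_cancel p n q hn
      rw [hG]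
      symm
      apply LinearMap.ext
      intro x
      apply e.injective
      simp only [Module.End.mul_apply, LinearMap.comp_apply, LinearEquiv.coe_coe,
        LinearEquiv.apply_symm_apply]
      apply Subtype.ext
      rw [LinearMap.codRestrict_apply, LinearEquiv.ofInjective_apply]
      simp
  · intro G hG
    apply extPow_cancel p n q hn
    rw [mul_assoc, hG, mul_smul_comm, smul_mul_assoc, mul_one, one_mul]
  · intro G hG
    apply extPow_cancel p n 1 hn
    rw [hG, ← extPowMap_mul, Fmap_mul_Vmap, extPowMap_smul_one, pow_one]
end
end

section
/- For all 0 ≤ q ≤ n, A ∈ Λ^q M and B ∈ Λ^{n−q} M, the scalar product satisfies ⟨(Λ^q V)A, B⟩ = (−1)^{n−1}·⟨A, F_{n−q} B⟩; equivalently, (Λ^q V)A ∧ B = (−1)^{n−1}·(A ∧ F_{n−q} B) in Λ^n M. -/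
set_option synthInstance.maxHeartbeats 1000000
set_option maxHeartbeats 1000000

/-! Statement 5: for `0 ≤ q ≤ n`, `A ∈ Λ^q M`, `B ∈ Λ^(n-q) M`:
`(Λ^q V)A ∧ B = (-1)^(n-1) · (A ∧ F_{n-q} B)` in `Λ^n M` (equivalently
`⟨(Λ^q V)A, B⟩ = (-1)^(n-1)·⟨A, F_{n-q} B⟩` for the scalar product). -/

noncomputable section

section helpers

theorem aux_VF (p n : ℕ) [Fact p.Prime] : Vmap p n ∘ₗ Fmap p n = (p : ℤ_[p]) • LinearMap.id := by
  refine LinearMap.ext fun x => funext fun j => ?_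
  have hj := j.isLt
  by_cases h : (j : ℕ) + 1 < n
  · simp [Vmap, Fmap, h]
  · have : (⟨n - 1, by omega⟩ : Fin n) = j := by ext; simp; omega
    simp [Vmap, Fmap, h, this]

theorem aux_extV (p m : ℕ) [Fact p.Prime] :
    (ExteriorAlgebra.ιMulti ℤ_[p] (m+1) (M := Fin (m+1) → ℤ_[p])).compLinearMap (Vmap p (m+1)) =
      ((-1 : ℤ_[p]) ^ m * p) • ExteriorAlgebra.ιMulti ℤ_[p] (m+1) := by
  have key : ∀ i : Fin (m+1), Vmap p (m+1) (Pi.basisFun ℤ_[p] (Fin (m+1)) i) =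
      (if i = 0 then (p : ℤ_[p]) else 1) •
        (Pi.basisFun ℤ_[p] (Fin (m+1)) ((finRotate (m+1)).symm i)) := by
    intro i
    obtain ⟨k, rfl⟩ := (finRotate (m+1)).surjective i
    rw [Equiv.symm_apply_apply]
    ext j
    have hj := j.isLt
    have hk := k.isLt
    by_cases h : (j : ℕ) + 1 < m + 1
    all_goals
      have hc := coe_finRotate k
      have e1 : finRotate (m+1) k = 0 ↔ (k : ℕ) = m := by
        rw [Fin.ext_iff, hc]
        by_cases hl : k = Fin.last m
        · simp [hl]
        · have : (k : ℕ) ≠ m := fun h => hl (Fin.ext h)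
          simp [hl, this]
      have e2 : ∀ i : Fin (m+1), i = finRotate (m+1) k ↔
          ((k : ℕ) = m ∧ (i : ℕ) = 0) ∨ ((k : ℕ) ≠ m ∧ (i : ℕ) = k + 1) := by
        intro i
        rw [Fin.ext_iff, hc]
        by_cases hl : k = Fin.last m
        · simp [hl]
        · have : (k : ℕ) ≠ m := fun h => hl (Fin.ext h)
          simp [hl, this]
      simp only [Vmap, LinearMap.pi_apply, h, dif_pos, dif_neg, not_false_eq_true,
        LinearMap.smul_apply, LinearMap.proj_apply, Pi.basisFun_apply, Pi.single_apply,
        Pi.smul_apply, e1, e2, Fin.ext_iff, smul_eq_mul]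
      try simp only [and_true, and_false, or_false, false_or]
      split_ifs <;> first | omega | (exfalso; simp_all; done) | (exfalso; simp_all; omega) | simp
  refine Module.Basis.ext_alternating (Pi.basisFun ℤ_[p] (Fin (m+1))) ?_
  intro v hv
  have hb : Function.Bijective v := Finite.injective_iff_bijective.mp hv
  obtain ⟨σ, rfl⟩ : ∃ σ : Equiv.Perm (Fin (m+1)), ⇑σ = v := ⟨Equiv.ofBijective v hb, rfl⟩
  have e1 := AlternatingMap.map_perm ((ExteriorAlgebra.ιMulti ℤ_[p] (m+1) (M := Fin (m+1) → ℤ_[p])).compLinearMap (Vmap p (m+1))) (Pi.basisFun ℤ_[p] (Fin (m+1))) σ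
  have e2 := AlternatingMap.map_perm (((-1 : ℤ_[p]) ^ m * p) • ExteriorAlgebra.ιMulti ℤ_[p] (m+1) (M := Fin (m+1) → ℤ_[p])) (Pi.basisFun ℤ_[p] (Fin (m+1))) σ
  refine e1.trans (Eq.trans ?_ e2.symm)
  congr 1
  rw [AlternatingMap.compLinearMap_apply]
  simp only [key]
  have e3 := AlternatingMap.map_perm (ExteriorAlgebra.ιMulti ℤ_[p] (m+1) (M := Fin (m+1) → ℤ_[p])) (Pi.basisFun ℤ_[p] (Fin (m+1))) (finRotate (m+1)).symm
  have e4 := (ExteriorAlgebra.ιMulti ℤ_[p] (m+1) (M := Fin (m+1) → ℤ_[p])).toMultilinearMap.map_smul_univ (fun i => if i = 0 then (p : ℤ_[p]) else 1) (fun i => Pi.basisFun ℤ_[p] (Fin (m+1)) ((finRotate (m+1)).symm i))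
  refine e4.trans ?_
  rw [Finset.prod_ite_eq' Finset.univ (0 : Fin (m+1)) (fun _ => (p : ℤ_[p]))]
  simp only [Finset.mem_univ, if_true]
  refine (congrArg _ e3).trans ?_
  rw [Equiv.Perm.sign_symm, sign_finRotate]
  rw [AlternatingMap.smul_apply, mul_comm, mul_smul]
  congr 1
  rcases Nat.even_or_odd m with h | h <;> simp [h.neg_one_pow]

theorem aux_top (p m : ℕ) [Fact p.Prime] (x : ExteriorAlgebra ℤ_[p] (Fin (m+1) → ℤ_[p]))
    (hx : x ∈ ⋀[ℤ_[p]]^(m+1) (Fin (m+1) → ℤ_[p])) :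
    ExteriorAlgebra.map (Vmap p (m+1)) x = ((-1 : ℤ_[p]) ^ m * p) • x := by
  rw [← ExteriorAlgebra.ιMulti_span_fixedDegree] at hx
  induction hx using Submodule.span_induction with
  | mem x h =>
    obtain ⟨v, rfl⟩ := h
    rw [ExteriorAlgebra.map_apply_ιMulti]
    exact DFunLike.congr_fun (aux_extV p m) v
  | zero => simp
  | add x y _ _ hx hy => rw [map_add, hx, hy, smul_add]
  | smul a x _ hx => rw [map_smul, hx, smul_comm]

theorem aux_scal {R : Type} [CommRing R] {M : Type} [AddCommGroup M] [Module R M] (k : ℕ) (c : R)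
    (x : ExteriorAlgebra R M) (hx : x ∈ ⋀[R]^k M) :
    ExteriorAlgebra.map (c • LinearMap.id : M →ₗ[R] M) x = c ^ k • x := by
  rw [← ExteriorAlgebra.ιMulti_span_fixedDegree] at hx
  induction hx using Submodule.span_induction with
  | mem x h =>
    obtain ⟨v, rfl⟩ := h
    rw [ExteriorAlgebra.map_apply_ιMulti]
    have := (ExteriorAlgebra.ιMulti R k (M := M)).toMultilinearMap.map_smul_univ (fun _ => c) v
    rw [Finset.prod_const, Finset.card_univ, Fintype.card_fin] at this
    exact this
  | zero => simp
  | add x y _ _ hx hy => rw [map_add, hx, hy, smul_add]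
  | smul a x _ hx => rw [map_smul, hx, smul_comm]

theorem aux_coe {R : Type} [CommRing R] {M : Type} [AddCommGroup M] [Module R M]
    (q : ℕ) (f : M →ₗ[R] M) (x : ⋀[R]^q M) :
    (extPowMap q f x : ExteriorAlgebra R M) = ExteriorAlgebra.map f (x : ExteriorAlgebra R M) := rfl

end helpers

theorem statement5 (p n q : ℕ) [Fact p.Prime] (hp : Odd p) (hn : 1 ≤ n) (hq : q ≤ n)
    (Fnq : Module.End ℤ_[p] (⋀[ℤ_[p]]^(n - q) (Fin n → ℤ_[p])))
    (hFnq : Fnq * extPowMap (n - q) (Vmap p n) =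
      (p : ℤ_[p]) • (1 : Module.End ℤ_[p] (⋀[ℤ_[p]]^(n - q) (Fin n → ℤ_[p]))))
    (A : ⋀[ℤ_[p]]^q (Fin n → ℤ_[p])) (B : ⋀[ℤ_[p]]^(n - q) (Fin n → ℤ_[p])) :
    (↑(extPowMap q (Vmap p n) A) * (↑B : ExteriorAlgebra ℤ_[p] (Fin n → ℤ_[p]))) =
      ((-1 : ℤ_[p]) ^ (n - 1)) •
        ((↑A : ExteriorAlgebra ℤ_[p] (Fin n → ℤ_[p])) * ↑(Fnq B)) := by
  obtain ⟨m, rfl⟩ : ∃ m, n = m + 1 := ⟨n - 1, by omega⟩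
  set E := ExteriorAlgebra ℤ_[p] (Fin (m+1) → ℤ_[p])
  generalize hk : m + 1 - q = k at *
  have hVF : ∀ x : ⋀[ℤ_[p]]^k (Fin (m+1) → ℤ_[p]),
      extPowMap k (Vmap p (m+1)) (extPowMap k (Fmap p (m+1)) x) = (p : ℤ_[p]) ^ k • x := by
    intro x
    apply Subtype.ext
    rw [aux_coe, aux_coe, ← AlgHom.comp_apply, ExteriorAlgebra.map_comp_map, aux_VF,
      aux_scal k _ _ x.2]
    rfl
  have hF : (p : ℤ_[p]) ^ k • Fnq B = (p : ℤ_[p]) • extPowMap k (Fmap p (m+1)) B := by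
    have := LinearMap.congr_fun hFnq (extPowMap k (Fmap p (m+1)) B)
    rw [Module.End.mul_apply, hVF, map_smul] at this
    simpa using this
  have mem : ∀ (x : ⋀[ℤ_[p]]^q (Fin (m+1) → ℤ_[p])) (y : ⋀[ℤ_[p]]^k (Fin (m+1) → ℤ_[p])),
      ((x : E) * (y : E)) ∈ ⋀[ℤ_[p]]^(m+1) (Fin (m+1) → ℤ_[p]) := by
    intro x y
    have := Submodule.mul_mem_mul x.2 y.2
    rw [← pow_add, show q + k = m + 1 by omega] at this
    exact this
  have hp0 : (p : ℤ_[p]) ^ k ≠ 0 := pow_ne_zero _ (by exact_mod_cast (Fact.out : p.Prime).ne_zero)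
  have main : (p : ℤ_[p]) ^ k • ((extPowMap q (Vmap p (m+1)) A : E) * (B : E)) =
      (p : ℤ_[p]) ^ k • (((-1 : ℤ_[p]) ^ (m + 1 - 1)) • ((A : E) * (Fnq B : E))) := by
    have h1 : (p : ℤ_[p]) ^ k • (B : E) =
        ExteriorAlgebra.map (Vmap p (m+1)) (extPowMap k (Fmap p (m+1)) B : E) := by
      have := congrArg Subtype.val (hVF B)
      exact this.symm
    have h2 : (p : ℤ_[p]) ^ k • (Fnq B : E) = (p : ℤ_[p]) • (extPowMap k (Fmap p (m+1)) B : E) :=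
      congrArg Subtype.val hF
    rw [← mul_smul_comm, h1, aux_coe, ← map_mul, aux_top p m _ (mem _ _),
      smul_comm ((p : ℤ_[p]) ^ k), ← mul_smul_comm ((p : ℤ_[p]) ^ k), h2, mul_smul_comm, mul_smul, Nat.add_sub_cancel]
  have inj := smul_right_injective (⋀[ℤ_[p]]^(m+1) (Fin (m+1) → ℤ_[p])) hp0
  exact congrArg Subtype.val (@inj ⟨_, mem _ _⟩ ⟨_, Submodule.smul_mem _ _ (mem _ _)⟩ (Subtype.ext main))
end
end

section
/- For 1 ≤ q ≤ n, the quotient Λ^q M / (Λ^q V)(Λ^q M) is an F_p-vector space of dimension binom(n−1, q−1); a basis is given by the images of the basis vectors a_{i_1} ∧ ⋯ ∧ a_{i_{q−1}} ∧ a_{n−1} with 0 ≤ i_1 < ⋯ < i_{q−1} < n−1. -/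
set_option synthInstance.maxHeartbeats 1000000
set_option maxHeartbeats 1000000

/-! Statement 7: for `1 ≤ q ≤ n` (written `q+1` below), the quotient
`Λ^q M / (Λ^q V)(Λ^q M)` is an `F_p`-vector space of dimension `binom (n-1) (q-1)`,
with basis the images of the wedges `a_{i₁} ∧ ⋯ ∧ a_{i_{q-1}} ∧ a_{n-1}`,
`0 ≤ i₁ < ⋯ < i_{q-1} < n-1`. -/

noncomputable section

/-- The wedge `v₀ ∧ ⋯ ∧ v_{q-1}` as an element of `⋀[R]^q M`. -/
def wedge {R : Type} [CommRing R] {M : Type} [AddCommGroup M] [Module R M]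
    (q : ℕ) (v : Fin q → M) : ⋀[R]^q M :=
  ⟨ExteriorAlgebra.ιMulti R q v, ExteriorAlgebra.ιMulti_range R q (Set.mem_range_self v)⟩

/-- Index set: strictly increasing `q`-tuples `i₁ < ⋯ < i_q` with all entries `< n - 1`. -/
def GoodIdx (n q : ℕ) : Type :=
  {f : Fin q → Fin n // StrictMono f ∧ ∀ j, ((f j : ℕ)) < n - 1}

/-- The wedge `a_{i₁} ∧ ⋯ ∧ a_{i_q} ∧ a_{n-1}` in `⋀^(q+1) (ℤ_p^n)`. -/
def quotBasisVec (p n q : ℕ) [Fact p.Prime] (hq : q + 1 ≤ n) (f : GoodIdx n q) :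
    ⋀[ℤ_[p]]^(q + 1) (Fin n → ℤ_[p]) :=
  wedge (q + 1)
    (Fin.snoc (fun j => Pi.single (f.1 j) (1 : ℤ_[p]))
      (Pi.single (⟨n - 1, by omega⟩ : Fin n) (1 : ℤ_[p])))

namespace S7

lemma wedge_eq {R : Type} [CommRing R] {M : Type} [AddCommGroup M] [Module R M]
    (q : ℕ) (v : Fin q → M) : wedge (R := R) q v = exteriorPower.ιMulti R q v := rfl

lemma extPowMap_wedge {R : Type} [CommRing R] {M : Type} [AddCommGroup M] [Module R M]
    (q : ℕ) (f : M →ₗ[R] M) (v : Fin q → M) :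
    extPowMap q f (exteriorPower.ιMulti R q v) = exteriorPower.ιMulti R q (f ∘ v) := by
  apply Subtype.ext
  exact ExteriorAlgebra.map_apply_ιMulti f v

/-- The standard basis vector `a_i`. -/
abbrev e (p n : ℕ) [Fact p.Prime] (i : Fin n) : Fin n → ℤ_[p] := Pi.single i 1

lemma V_succ (p n : ℕ) [Fact p.Prime] (i : ℕ) (h : i + 1 < n) :
    Vmap p n (e p n ⟨i + 1, h⟩) = e p n ⟨i, by omega⟩ := by
  ext j
  simp only [Vmap, LinearMap.pi_apply]
  split_ifs with hj
  · simp [Pi.single_apply, Fin.ext_iff]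
  · have : (j : ℕ) ≠ i := by omega
    simp [Pi.single_apply, Fin.ext_iff, this]

lemma V_zero (p n : ℕ) [Fact p.Prime] (h : 0 < n) :
    Vmap p n (e p n ⟨0, h⟩) = (p : ℤ_[p]) • e p n ⟨n - 1, by omega⟩ := by
  ext j
  simp only [Vmap, LinearMap.pi_apply]
  split_ifs with hj
  · have : (j : ℕ) ≠ n - 1 := by omega
    simp [Pi.single_apply, Fin.ext_iff, this]
  · have : (j : ℕ) = n - 1 := by omega
    simp [Pi.single_apply, Fin.ext_iff, this]

lemma V_last (p n : ℕ) [Fact p.Prime] (h : 0 < n) (x : Fin n → ℤ_[p]) :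
    Vmap p n x ⟨n - 1, by omega⟩ = (p : ℤ_[p]) * x ⟨0, h⟩ := by
  simp only [Vmap, LinearMap.pi_apply]
  rw [dif_neg (by simp; omega)]
  simp

lemma span_e (p n : ℕ) [Fact p.Prime] : Submodule.span ℤ_[p] (Set.range (e p n)) = ⊤ := by
  have := (Pi.basisFun ℤ_[p] (Fin n)).span_eq
  convert this using 3
  ext i
  simp

/-- wedges avoiding `a_{n-1}` lie in the range. -/
lemma mem_of_lt (p n q : ℕ) [Fact p.Prime] (f : Fin q → Fin n)
    (hf : ∀ j, (f j : ℕ) < n - 1) :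
    exteriorPower.ιMulti ℤ_[p] q (e p n ∘ f) ∈ LinearMap.range (extPowMap q (Vmap p n)) := by
  refine ⟨exteriorPower.ιMulti ℤ_[p] q
    (fun j => e p n ⟨f j + 1, by have := hf j; omega⟩), ?_⟩
  rw [extPowMap_wedge]
  congr 1
  ext1 j
  exact V_succ p n _ _

lemma p_mem (p n q : ℕ) [Fact p.Prime] (f : Fin q → Fin n) (hinj : Function.Injective f) :
    (p : ℤ_[p]) • exteriorPower.ιMulti ℤ_[p] q (e p n ∘ f) ∈
      LinearMap.range (extPowMap q (Vmap p n)) := by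
  by_cases hf : ∀ j, (f j : ℕ) < n - 1
  · exact Submodule.smul_mem _ _ (mem_of_lt p n q f hf)
  push Not at hf
  obtain ⟨j, hj⟩ := hf
  have hn : 0 < n := (f j).pos
  have hj' : f j = ⟨n - 1, by omega⟩ := Fin.ext (by have := (f j).isLt; simp; omega)
  have hlt : ∀ i, i ≠ j → (f i : ℕ) + 1 < n := by
    intro i hi
    have h1 : f i ≠ f j := fun h => hi (hinj h)
    rw [hj', Ne, Fin.ext_iff] at h1
    have := (f i).isLt
    simp at h1
    omega
  refine ⟨exteriorPower.ιMulti ℤ_[p] q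
    (fun i => if h : i = j then e p n ⟨0, hn⟩ else e p n ⟨f i + 1, hlt i h⟩), ?_⟩
  rw [extPowMap_wedge]
  have h2 : (p : ℤ_[p]) • exteriorPower.ιMulti ℤ_[p] q (e p n ∘ f) =
      exteriorPower.ιMulti ℤ_[p] q (Function.update (e p n ∘ f) j ((p : ℤ_[p]) • (e p n (f j)))) := by
    rw [AlternatingMap.map_update_smul]
    congr 2
    exact (Function.update_eq_self j (e p n ∘ f)).symm
  rw [h2]
  congr 1
  ext1 i
  by_cases h : i = j
  · subst h
    simp only [Function.comp_apply, dif_pos, Function.update_self]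
    rw [V_zero, hj']
  · simp only [Function.comp_apply, dif_neg h, Function.update_of_ne h]
    exact V_succ p n _ _

lemma top_le {p n q : ℕ} [Fact p.Prime] (S : Submodule ℤ_[p] (⋀[ℤ_[p]]^q (Fin n → ℤ_[p])))
    (h : ∀ f : Fin q ↪o Fin n, exteriorPower.ιMulti ℤ_[p] q (e p n ∘ f) ∈ S) (x) : x ∈ S := by
  have h1 : (⊤ : Submodule ℤ_[p] (⋀[ℤ_[p]]^q (Fin n → ℤ_[p]))) ≤ S := by
    rw [← exteriorPower.ιMulti_family_span_of_span ℤ_[p] (span_e p n), Submodule.span_le]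
    rintro _ ⟨s, rfl⟩
    exact h _
  exact h1 trivial

/-- extension of a good index by `n-1` -/
def ext (n q : ℕ) (hq : q + 1 ≤ n) (f : GoodIdx n q) : Fin (q + 1) ↪o Fin n :=
  OrderEmbedding.ofStrictMono (Fin.snoc (α := fun _ => Fin n) f.1 ⟨n - 1, by omega⟩) (by
    intro i j hij
    induction j using Fin.lastCases with
    | last =>
      induction i using Fin.lastCases with
      | last => exact absurd hij (lt_irrefl _)
      | cast i =>
        simp only [Fin.snoc_castSucc, Fin.snoc_last, Fin.lt_def]
        exact f.2.2 i
    | cast j =>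
      induction i using Fin.lastCases with
      | last => exact absurd hij (not_lt.mpr (Fin.le_last _))
      | cast i =>
        simp only [Fin.snoc_castSucc]
        exact f.2.1 (by simpa using hij))

lemma ext_last (n q : ℕ) (hq : q + 1 ≤ n) (f : GoodIdx n q) :
    ext n q hq f (Fin.last q) = ⟨n - 1, by omega⟩ := by
  change Fin.snoc (α := fun _ => Fin n) f.1 ⟨n - 1, by omega⟩ (Fin.last q) = _
  rw [Fin.snoc_last]

lemma ext_cast (n q : ℕ) (hq : q + 1 ≤ n) (f : GoodIdx n q) (i : Fin q) :
    ext n q hq f i.castSucc = f.1 i := by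
  change Fin.snoc (α := fun _ => Fin n) f.1 ⟨n - 1, by omega⟩ i.castSucc = _
  rw [Fin.snoc_castSucc]

lemma ext_inj (n q : ℕ) (hq : q + 1 ≤ n) : Function.Injective (ext n q hq) := by
  intro f g h
  apply Subtype.ext
  ext1 i
  rw [← ext_cast n q hq f, ← ext_cast n q hq g, h]

lemma quot_eq (p n q : ℕ) [Fact p.Prime] (hq : q + 1 ≤ n) (f : GoodIdx n q) :
    quotBasisVec p n q hq f = exteriorPower.ιMulti ℤ_[p] (q + 1) (e p n ∘ ext n q hq f) := by
  rw [quotBasisVec, wedge_eq]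
  congr 1
  ext1 i
  induction i using Fin.lastCases with
  | last => simp [ext_last]
  | cast i => simp [ext_cast]

instance (n q : ℕ) : Finite (GoodIdx n q) := by unfold GoodIdx; infer_instance

lemma card_good (n q : ℕ) : Nat.card (GoodIdx n q) = Nat.choose (n - 1) q := by
  have E : GoodIdx n q ≃ (Fin q ↪o Fin (n - 1)) :=
    { toFun := fun f => OrderEmbedding.ofStrictMono (fun j => ⟨f.1 j, f.2.2 j⟩)
        (fun i j h => f.2.1 h)
      invFun := fun g => ⟨fun j => ⟨g j, by have := (g j).isLt; omega⟩,
        fun i j h => g.strictMono h, fun j => (g j).isLt⟩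
      left_inv := fun f => rfl
      right_inv := fun g => by ext; rfl }
  rw [Nat.card_congr (E.trans Set.powersetCard.ofFinEmbEquiv), Set.powersetCard.card]
  simp

/-- coordinate functional -/
def phi (p n q : ℕ) [Fact p.Prime] (g : Fin q → Fin n) :
    Module.Dual ℤ_[p] (⋀[ℤ_[p]]^q (Fin n → ℤ_[p])) :=
  exteriorPower.pairingDual ℤ_[p] (Fin n → ℤ_[p]) q
    (exteriorPower.ιMulti ℤ_[p] q
      ((fun i : Fin n => (LinearMap.proj i : Module.Dual ℤ_[p] (Fin n → ℤ_[p]))) ∘ g))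

lemma phi_quot (p n q : ℕ) [Fact p.Prime] (hq : q + 1 ≤ n) (f g : GoodIdx n q) [Decidable (g = f)] :
    phi p n (q + 1) (ext n q hq g) (quotBasisVec p n q hq f) = if g = f then 1 else 0 := by
  have h0 : ∀ ⦃i j : Fin n⦄, i ≠ j →
      (LinearMap.proj i : Module.Dual ℤ_[p] (Fin n → ℤ_[p])) (e p n j) = 0 := by
    intro i j h
    simp [h]
  rw [quot_eq, phi]
  split_ifs with h
  · subst h
    exact exteriorPower.pairingDual_apply_apply_eq_one (e p n) _ (by simp) h0 _ _
  · exact exteriorPower.pairingDual_apply_apply_eq_one_zero (e p n) _ h0 _ _ _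
      (fun h' => h (ext_inj n q hq h'))

lemma phi_V (p n q : ℕ) [Fact p.Prime] (hq : q + 1 ≤ n) (g : GoodIdx n q)
    (x : ⋀[ℤ_[p]]^(q + 1) (Fin n → ℤ_[p])) :
    (p : ℤ_[p]) ∣ phi p n (q + 1) (ext n q hq g) (extPowMap (q + 1) (Vmap p n) x) := by
  rw [← Ideal.mem_span_singleton]
  refine top_le (Submodule.comap ((phi p n (q + 1) (ext n q hq g)) ∘ₗ
    (extPowMap (q + 1) (Vmap p n))) (Ideal.span {(p : ℤ_[p])})) ?_ x
  intro f
  rw [Submodule.mem_comap, LinearMap.comp_apply, extPowMap_wedge, phi,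
    exteriorPower.pairingDual_ιMulti_ιMulti, Ideal.mem_span_singleton, Matrix.det_apply]
  refine Finset.dvd_sum fun σ _ => ?_
  have : (p : ℤ_[p]) ∣ ∏ i, Matrix.of (fun i j =>
      ((fun i : Fin n => (LinearMap.proj i : Module.Dual ℤ_[p] (Fin n → ℤ_[p]))) ∘
        (ext n q hq g)) j ((Vmap p n ∘ e p n ∘ f) i)) (σ i) i := by
    refine dvd_trans ?_ (Finset.dvd_prod_of_mem _ (Finset.mem_univ (Fin.last q)))
    simp only [Matrix.of_apply, Function.comp_apply, ext_last, LinearMap.proj_apply]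
    rw [V_last p n (by omega)]
    exact dvd_mul_right _ _
  rw [Units.smul_def, zsmul_eq_mul]
  exact Dvd.dvd.mul_left this _

end S7

theorem statement7 (p n q : ℕ) [Fact p.Prime] (hp : Odd p) (hq : q + 1 ≤ n) :
    -- `p · Λ^(q+1) M ⊆ (Λ^(q+1) V)(Λ^(q+1) M)`, so the quotient is an `F_p`-vector space
    (∀ x : ⋀[ℤ_[p]]^(q + 1) (Fin n → ℤ_[p]),
      (p : ℤ_[p]) • x ∈ LinearMap.range (extPowMap (q + 1) (Vmap p n))) ∧
    -- there are `binom (n-1) q` prospective basis vectors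
    Nat.card (GoodIdx n q) = Nat.choose (n - 1) q ∧
    -- their images span the quotient ...
    (∀ x : ⋀[ℤ_[p]]^(q + 1) (Fin n → ℤ_[p]), ∃ c : GoodIdx n q → ℤ_[p],
      x - ∑ᶠ f, c f • quotBasisVec p n q hq f ∈
        LinearMap.range (extPowMap (q + 1) (Vmap p n))) ∧
    -- ... and are linearly independent over `F_p` in the quotient
    (∀ c : GoodIdx n q → ℤ_[p],
      (∑ᶠ f, c f • quotBasisVec p n q hq f) ∈
          LinearMap.range (extPowMap (q + 1) (Vmap p n)) →
        ∀ f, (p : ℤ_[p]) ∣ c f) := by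
  classical
  haveI : Fintype (GoodIdx n q) := Fintype.ofFinite _
  refine ⟨?_, S7.card_good n q, ?_, ?_⟩
  · intro x
    refine S7.top_le (p := p) (Submodule.comap ((p : ℤ_[p]) • LinearMap.id)
      (LinearMap.range (extPowMap (q + 1) (Vmap p n)))) (fun f => ?_) x
    exact S7.p_mem p n (q + 1) f f.injective
  · intro x
    have hx : x ∈ LinearMap.range (extPowMap (q + 1) (Vmap p n)) ⊔
        Submodule.span ℤ_[p] (Set.range (quotBasisVec p n q hq)) := by
      refine S7.top_le _ (fun f => ?_) x
      by_cases hl : (f (Fin.last q) : ℕ) < n - 1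
      · refine Submodule.mem_sup_left (S7.mem_of_lt p n (q + 1) f fun j => ?_)
        exact lt_of_le_of_lt (f.monotone (Fin.le_last j)) hl
      · have hl' : f (Fin.last q) = ⟨n - 1, by omega⟩ :=
          Fin.ext (by have := (f (Fin.last q)).isLt; simp only; omega)
        have hb : StrictMono (fun j : Fin q => f j.castSucc) ∧
            ∀ j : Fin q, ((f j.castSucc : Fin n) : ℕ) < n - 1 := by
          refine ⟨fun i j h => f.strictMono (by simpa using h), fun j => ?_⟩
          have h1 : f j.castSucc < f (Fin.last q) := f.strictMono (Fin.castSucc_lt_last j)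
          rw [hl', Fin.lt_def] at h1
          exact h1
        obtain ⟨g, hg⟩ : ∃ g : GoodIdx n q, g.1 = fun j : Fin q => f j.castSucc := ⟨⟨_, hb⟩, rfl⟩
        refine Submodule.mem_sup_right (Submodule.subset_span ⟨g, ?_⟩)
        rw [S7.quot_eq]
        congr 1
        ext1 i
        induction i using Fin.lastCases with
        | last => simp only [Function.comp_apply, S7.ext_last, hl']
        | cast i => simp only [Function.comp_apply, S7.ext_cast, hg]
    obtain ⟨y, hy, z, hz, rfl⟩ := Submodule.mem_sup.mp hx
    obtain ⟨c, rfl⟩ := (Submodule.mem_span_range_iff_exists_fun ℤ_[p]).mp hz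
    refine ⟨c, ?_⟩
    rw [finsum_eq_sum_of_fintype, add_sub_cancel_right]
    exact hy
  · rintro c ⟨x, hx⟩ g
    have h1 := S7.phi_V p n q hq g x
    rw [hx, finsum_eq_sum_of_fintype, map_sum] at h1
    simpa [S7.phi_quot] using h1
end
end

section
/- For every 1 ≤ q ≤ n, the map φ_q : Λ^q M → Λ^q_⊠(M) determined by a_{i_1} ∧ ⋯ ∧ a_{i_q} ↦ a_{i_1} ∘ ⋯ ∘ a_{i_q} (for 0 ≤ i_1 < ⋯ < i_q < n) is an isomorphism of R-modules, where Λ^q M carries the R-module structure given by the operators Λ^q V and F_q. -/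
set_option synthInstance.maxHeartbeats 1000000
set_option maxHeartbeats 1000000

/-! Statement 8: for `1 ≤ q ≤ n` (written `q = k+1`), the map
`φ_q : Λ^q M → Λ^q_⊠(M)` determined by `a_{i₁} ∧ ⋯ ∧ a_{i_q} ↦ a_{i₁} ∘ ⋯ ∘ a_{i_q}` is
an isomorphism of `R`-modules, where `Λ^q M` carries the `R`-module structure given by
the operators `Λ^q V` and `F_q`, and `Λ^q_⊠(M)` is the quotient of the iterated bilinear
product `M^{⊠q}` by the sign relations. -/

noncomputable section

noncomputable section

/-- A Dieudonné-bilinear map between `ℤ_p`-modules equipped with operators `F`, `V`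
(diagonal `V`, and `F` hooked across `V`), as in the definition of the bilinear
product of Dieudonné modules. -/
def IsDBilinear {p : ℕ} [Fact p.Prime] {M N P : Type}
    [AddCommGroup M] [Module ℤ_[p] M] [AddCommGroup N] [Module ℤ_[p] N]
    [AddCommGroup P] [Module ℤ_[p] P]
    (FM VM : Module.End ℤ_[p] M) (FN VN : Module.End ℤ_[p] N)
    (FP VP : Module.End ℤ_[p] P) (β : M →ₗ[ℤ_[p]] N →ₗ[ℤ_[p]] P) : Prop :=
  (∀ m n, FP (β (VM m) n) = β m (FN n)) ∧
  (∀ m n, FP (β m (VN n)) = β (FM m) n) ∧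
  (∀ m n, VP (β m n) = β (VM m) (VN n))

/-- `(P, β)` realizes the bilinear product `M ⊠ N` of Dieudonné modules: `β` is a
Dieudonné-bilinear map, `P` is itself a Dieudonné module, and `β` is universal among
Dieudonné-bilinear maps out of `M × N`: every such map to a Dieudonné module `Q`
factors uniquely through an `R`-module map (a `ℤ_p`-linear map commuting with `F`
and `V`) out of `P`.  This is exactly the defining universal property of `M ⊠ N`,
which the explicit construction `R ⊗_{ℤ_p[V]} (M ⊗ N)/∼` satisfies. -/
def IsBoxtimes (p : ℕ) [Fact p.Prime] {M N P : Type}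
    [AddCommGroup M] [Module ℤ_[p] M] [AddCommGroup N] [Module ℤ_[p] N]
    [AddCommGroup P] [Module ℤ_[p] P]
    (FM VM : Module.End ℤ_[p] M) (FN VN : Module.End ℤ_[p] N)
    (FP VP : Module.End ℤ_[p] P) (β : M →ₗ[ℤ_[p]] N →ₗ[ℤ_[p]] P) : Prop :=
  IsDBilinear FM VM FN VN FP VP β ∧
  FP * VP = (p : ℤ_[p]) • (1 : Module.End ℤ_[p] P) ∧
  VP * FP = (p : ℤ_[p]) • (1 : Module.End ℤ_[p] P) ∧
  ∀ (Q : Type) [AddCommGroup Q] [Module ℤ_[p] Q],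
    ∀ FQ VQ : Module.End ℤ_[p] Q,
    FQ * VQ = (p : ℤ_[p]) • (1 : Module.End ℤ_[p] Q) →
    VQ * FQ = (p : ℤ_[p]) • (1 : Module.End ℤ_[p] Q) →
    ∀ γ : M →ₗ[ℤ_[p]] N →ₗ[ℤ_[p]] Q, IsDBilinear FM VM FN VN FQ VQ γ →
    ∃! φ : P →ₗ[ℤ_[p]] Q,
      φ ∘ₗ (FP : P →ₗ[ℤ_[p]] P) = (FQ : Q →ₗ[ℤ_[p]] Q) ∘ₗ φ ∧
      φ ∘ₗ (VP : P →ₗ[ℤ_[p]] P) = (VQ : Q →ₗ[ℤ_[p]] Q) ∘ₗ φ ∧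
      ∀ m n, φ (β m n) = γ m n

/-- The iterated circle product `m₁ ∘ ⋯ ∘ m_{k+1} ∈ M^{⊠(k+1)}`, for a chosen chain of
bilinear products `P (k+1) = M^{⊠(k+1)}` (with `P 1 = M` via `e1` and bilinear maps
`bβ k : M^{⊠(k+1)} ⊗ M → M^{⊠(k+2)}`). -/
def circ {p : ℕ} [Fact p.Prime] {M : Type} [AddCommGroup M] [Module ℤ_[p] M]
    (P : ℕ → Type) [∀ k, AddCommGroup (P k)] [∀ k, Module ℤ_[p] (P k)]
    (e1 : M ≃ₗ[ℤ_[p]] P 1)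
    (bβ : ∀ k, P (k + 1) →ₗ[ℤ_[p]] M →ₗ[ℤ_[p]] P (k + 2)) :
    ∀ k : ℕ, (Fin (k + 1) → M) → P (k + 1)
  | 0, m => e1 (m 0)
  | k + 1, m => bβ k (circ P e1 bβ k (Fin.init m)) (m (Fin.last (k + 1)))

/-- The `R`-submodule of `M^{⊠(k+1)}` generated by the sign relations
`m_{σ(1)} ∘ ⋯ ∘ m_{σ(k+1)} - sgn(σ)·m₁ ∘ ⋯ ∘ m_{k+1}`; the quotient by it is the
exterior power `Λ^{k+1}_⊠(M)`. -/
def signRel {p : ℕ} [Fact p.Prime] {M : Type} [AddCommGroup M] [Module ℤ_[p] M]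
    (P : ℕ → Type) [∀ k, AddCommGroup (P k)] [∀ k, Module ℤ_[p] (P k)]
    (FP VP : ∀ k, Module.End ℤ_[p] (P k))
    (e1 : M ≃ₗ[ℤ_[p]] P 1)
    (bβ : ∀ k, P (k + 1) →ₗ[ℤ_[p]] M →ₗ[ℤ_[p]] P (k + 2))
    (k : ℕ) : Submodule ℤ_[p] (P (k + 1)) :=
  Submodule.span ℤ_[p]
    {x | ∃ (a b : ℕ) (σ : Equiv.Perm (Fin (k + 1))) (m : Fin (k + 1) → M),
      x = (FP (k + 1) ^ a * VP (k + 1) ^ b)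
        (circ P e1 bβ k (m ∘ σ) - (Equiv.Perm.sign σ : ℤ) • circ P e1 bβ k m)}

section helpers

variable {p n : ℕ} [Fact p.Prime]

lemma FV_eq (x : (Fin n → ℤ_[p])) : Fmap p n (Vmap p n x) = (p : ℤ_[p]) • x := by
  funext j
  have hj := j.isLt
  by_cases h : (j : ℕ) = 0
  · have h1 : ¬ (n - 1 + 1 < n) := by omega
    have h0 : (⟨0, j.pos⟩ : Fin n) = j := by ext; simp [h]
    simp [Fmap, Vmap, h, h1, h0]
  · have h1 : (j : ℕ) - 1 + 1 < n := by omega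
    have h2 : (j : ℕ) - 1 + 1 = j := by omega
    simp [Fmap, Vmap, h, h2]

lemma VF_eq (x : (Fin n → ℤ_[p])) : Vmap p n (Fmap p n x) = (p : ℤ_[p]) • x := by
  funext j
  have hj := j.isLt
  by_cases h : (j : ℕ) + 1 < n
  · simp [Fmap, Vmap, h]
  · have h1 : n - 1 = j := by omega
    simp [Fmap, Vmap, h, h1]

lemma V_single (i : Fin n) (h : (i : ℕ) + 1 < n) :
    Vmap p n (Pi.single (⟨(i : ℕ) + 1, h⟩ : Fin n) 1) = Pi.single i 1 := by
  funext j
  have hj := j.isLt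
  by_cases h1 : (j : ℕ) + 1 < n
  · simp [Vmap, h1, Pi.single_apply, Fin.ext_iff]
  · have : j ≠ i := by rintro rfl; exact h1 h
    simp [Vmap, h1, Fin.ext_iff, this]

lemma ext_update {q : ℕ} {N : Type} [AddCommGroup N] [Module ℤ_[p] N]
    {f g : ⋀[ℤ_[p]]^(q + 1) (Fin n → ℤ_[p]) →ₗ[ℤ_[p]] N}
    (h : ∀ (m : Fin (q + 1) → (Fin n → ℤ_[p])) (i : Fin (q + 1)) (x : (Fin n → ℤ_[p])),
      f (exteriorPower.ιMulti ℤ_[p] (q + 1) (Function.update (Vmap p n ∘ m) i x)) =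
      g (exteriorPower.ιMulti ℤ_[p] (q + 1) (Function.update (Vmap p n ∘ m) i x))) : f = g := by
  apply exteriorPower.linearMap_ext
  refine Module.Basis.ext_alternating (Pi.basisFun ℤ_[p] (Fin n)) fun v hv => ?_
  have key : ∃ i, ∀ j, j ≠ i → (v j : ℕ) + 1 < n := by
    by_cases hi : ∃ i, (v i : ℕ) + 1 = n
    · obtain ⟨i, hi⟩ := hi
      refine ⟨i, fun j hj => ?_⟩
      have h1 : v j ≠ v i := fun e => hj (hv e)
      have h2 : (v j : ℕ) ≠ v i := fun e => h1 (Fin.ext e)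
      have := (v j).isLt
      omega
    · push Not at hi
      refine ⟨0, fun j _ => ?_⟩
      have := (v j).isLt
      have := hi j
      omega
  obtain ⟨i, hi⟩ := key
  have e : (fun j => Pi.basisFun ℤ_[p] (Fin n) (v j)) =
      Function.update (Vmap p n ∘ fun j => if h : (v j : ℕ) + 1 < n then
        Pi.single (⟨(v j : ℕ) + 1, h⟩ : Fin n) 1 else 0) i (Pi.single (v i) 1) := by
    funext j
    by_cases hj : j = i
    · subst hj; simp
    · rw [Function.update_of_ne hj]
      simp only [Function.comp_apply, dif_pos (hi j hj), V_single, Pi.basisFun_apply]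
  simp only [LinearMap.compAlternatingMap_apply]
  rw [e]
  exact h _ _ _

lemma extPowMap_ιMulti (q : ℕ) (f : (Fin n → ℤ_[p]) →ₗ[ℤ_[p]] (Fin n → ℤ_[p])) (m : Fin q → (Fin n → ℤ_[p])) :
    extPowMap q f (exteriorPower.ιMulti ℤ_[p] q m) = exteriorPower.ιMulti ℤ_[p] q (f ∘ m) := by
  apply Subtype.ext
  exact ExteriorAlgebra.map_apply_ιMulti f m

lemma p_ne : (p : ℤ_[p]) ≠ 0 := by
  exact_mod_cast (Fact.out : p.Prime).ne_zero

lemma p_cancel {q : ℕ} {x y : ⋀[ℤ_[p]]^q (Fin n → ℤ_[p])} (h : (p : ℤ_[p]) • x = (p : ℤ_[p]) • y) : x = y :=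
  smul_right_injective _ p_ne h

lemma extV_injective (q : ℕ) : Function.Injective (extPowMap q (Vmap p n)) := by
  have h : (extPowMap q (Fmap p n)) ∘ₗ (extPowMap q (Vmap p n)) =
      ((p : ℤ_[p]) ^ q) • LinearMap.id := by
    apply exteriorPower.linearMap_ext
    ext1 m
    simp only [LinearMap.compAlternatingMap_apply, LinearMap.comp_apply, extPowMap_ιMulti,
      LinearMap.smul_apply, LinearMap.id_apply]
    have : (Fmap p n ∘ Vmap p n ∘ m) = fun i => (p : ℤ_[p]) • m i := by
      funext i; simp [FV_eq]
    rw [this]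
    have := (exteriorPower.ιMulti ℤ_[p] q).toMultilinearMap.map_smul_univ
      (fun _ => (p : ℤ_[p])) m
    simpa using this
  intro x y hxy
  have h2 := congrArg (extPowMap q (Fmap p n)) hxy
  have hx := LinearMap.congr_fun h x
  have hy := LinearMap.congr_fun h y
  simp only [LinearMap.comp_apply, LinearMap.smul_apply, LinearMap.id_apply] at hx hy
  rw [hx, hy] at h2
  exact smul_right_injective _ (pow_ne_zero q p_ne) h2

lemma V_update {q : ℕ} (m : Fin q → (Fin n → ℤ_[p])) (i : Fin q) (x : (Fin n → ℤ_[p])) :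
    extPowMap q (Vmap p n) (exteriorPower.ιMulti ℤ_[p] q (Function.update m i (Fmap p n x))) =
    (p : ℤ_[p]) • exteriorPower.ιMulti ℤ_[p] q (Function.update (Vmap p n ∘ m) i x) := by
  rw [extPowMap_ιMulti, Function.comp_update, VF_eq, AlternatingMap.map_update_smul]

lemma exists_Fq (q : ℕ) : ∃ G : Module.End ℤ_[p] (⋀[ℤ_[p]]^(q + 1) (Fin n → ℤ_[p])),
    ∀ x, extPowMap (q + 1) (Vmap p n) (G x) = (p : ℤ_[p]) • x := by
  have hr : ∀ x : ⋀[ℤ_[p]]^(q + 1) (Fin n → ℤ_[p]),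
      (p : ℤ_[p]) • x ∈ LinearMap.range (extPowMap (q + 1) (Vmap p n)) := by
    have : (LinearMap.range (extPowMap (q + 1) (Vmap p n))).mkQ ∘ₗ
        ((p : ℤ_[p]) • LinearMap.id) = 0 := by
      apply ext_update
      intro m i x
      simp only [LinearMap.comp_apply, LinearMap.smul_apply, LinearMap.id_apply,
        LinearMap.zero_apply]
      rw [← V_update]
      rw [Submodule.mkQ_apply, Submodule.Quotient.mk_eq_zero]
      exact ⟨_, rfl⟩
    intro x
    have h := LinearMap.congr_fun this x
    simpa only [LinearMap.comp_apply, LinearMap.smul_apply, LinearMap.id_apply,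
        LinearMap.zero_apply, Submodule.mkQ_apply, Submodule.Quotient.mk_eq_zero] using h
  let e := LinearEquiv.ofInjective _ (extV_injective (p := p) (n := n) (q + 1))
  refine ⟨e.symm.toLinearMap ∘ₗ
    (LinearMap.codRestrict _ ((p : ℤ_[p]) • LinearMap.id) hr), fun x => ?_⟩
  have := congrArg Subtype.val (e.apply_symm_apply (LinearMap.codRestrict _
    ((p : ℤ_[p]) • LinearMap.id) hr x))
  exact this

/-- right wedge multiplication -/
def wedgeR (q : ℕ) : (⋀[ℤ_[p]]^q (Fin n → ℤ_[p])) →ₗ[ℤ_[p]] (Fin n → ℤ_[p]) →ₗ[ℤ_[p]] (⋀[ℤ_[p]]^(q + 1) (Fin n → ℤ_[p])) :=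
  LinearMap.mk₂ ℤ_[p] (fun x m => ⟨x.1 * ExteriorAlgebra.ι ℤ_[p] m, by
      rw [ExteriorAlgebra.exteriorPower, pow_succ]
      exact Submodule.mul_mem_mul x.2 ⟨m, rfl⟩⟩)
    (fun x y m => Subtype.ext (by simp [add_mul]))
    (fun c x m => Subtype.ext (by simp))
    (fun x m m' => Subtype.ext (by simp [mul_add]))
    (fun c x m => Subtype.ext (by simp))

lemma wedgeR_ιMulti (q : ℕ) (m : Fin (q + 1) → (Fin n → ℤ_[p])) :
    wedgeR q (exteriorPower.ιMulti ℤ_[p] q (Fin.init m)) (m (Fin.last q)) =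
      exteriorPower.ιMulti ℤ_[p] (q + 1) m := by
  apply Subtype.ext
  simp only [wedgeR, LinearMap.mk₂_apply, exteriorPower.ιMulti_apply_coe,
    ExteriorAlgebra.ιMulti_apply, List.ofFn_succ_last, List.prod_append, List.prod_singleton]
  rfl

lemma extV_wedgeR (q : ℕ) (x : ⋀[ℤ_[p]]^q (Fin n → ℤ_[p])) (m : (Fin n → ℤ_[p])) :
    extPowMap (q + 1) (Vmap p n) (wedgeR q x m) =
      wedgeR q (extPowMap q (Vmap p n) x) (Vmap p n m) := by
  apply Subtype.ext
  show ExteriorAlgebra.map (Vmap p n) (x.1 * ExteriorAlgebra.ι ℤ_[p] m) =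
    ExteriorAlgebra.map (Vmap p n) x.1 * ExteriorAlgebra.ι ℤ_[p] (Vmap p n m)
  simp

section chain

/-- circ as a multilinear map -/
def circM (P : ℕ → Type) [∀ j, AddCommGroup (P j)] [∀ j, Module ℤ_[p] (P j)]
    (e1 : (Fin n → ℤ_[p]) ≃ₗ[ℤ_[p]] P 1)
    (bβ : ∀ j, P (j + 1) →ₗ[ℤ_[p]] (Fin n → ℤ_[p]) →ₗ[ℤ_[p]] P (j + 2))
    : ∀ k : ℕ, MultilinearMap ℤ_[p] (fun _ : Fin (k + 1) => (Fin n → ℤ_[p])) (P (k + 1))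
  | 0 => e1.toLinearMap.compMultilinearMap
      (MultilinearMap.ofSubsingleton ℤ_[p] (Fin n → ℤ_[p]) (Fin n → ℤ_[p]) (0 : Fin 1) LinearMap.id)
  | k + 1 => MultilinearMap.uncurryRight ((bβ k).compMultilinearMap (circM P e1 bβ k))

lemma circM_apply (P : ℕ → Type) [∀ j, AddCommGroup (P j)] [∀ j, Module ℤ_[p] (P j)]
    (e1 : (Fin n → ℤ_[p]) ≃ₗ[ℤ_[p]] P 1)
    (bβ : ∀ j, P (j + 1) →ₗ[ℤ_[p]] (Fin n → ℤ_[p]) →ₗ[ℤ_[p]] P (j + 2))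
    (k : ℕ) (m : Fin (k + 1) → (Fin n → ℤ_[p])) : circM P e1 bβ k m = circ P e1 bβ k m := by
  induction k with
  | zero => simp [circM, circ]
  | succ k ih =>
    simp only [circM, circ, MultilinearMap.uncurryRight_apply,
      LinearMap.compMultilinearMap_apply]
    rw [← ih]

lemma FVP (P : ℕ → Type) [∀ j, AddCommGroup (P j)] [∀ j, Module ℤ_[p] (P j)]
    (FP VP : ∀ j, Module.End ℤ_[p] (P j))
    (e1 : (Fin n → ℤ_[p]) ≃ₗ[ℤ_[p]] P 1)
    (he1F : ∀ x, FP 1 (e1 x) = e1 (Fmap p n x))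
    (he1V : ∀ x, VP 1 (e1 x) = e1 (Vmap p n x))
    (bβ : ∀ j, P (j + 1) →ₗ[ℤ_[p]] (Fin n → ℤ_[p]) →ₗ[ℤ_[p]] P (j + 2))
    (hbox : ∀ j, IsBoxtimes p (FP (j + 1)) (VP (j + 1)) (Fmap p n) (Vmap p n)
      (FP (j + 2)) (VP (j + 2)) (bβ j))
    (k : ℕ) (x : P (k + 1)) : FP (k + 1) (VP (k + 1) x) = (p : ℤ_[p]) • x ∧
    VP (k + 1) (FP (k + 1) x) = (p : ℤ_[p]) • x := by
  cases k with
  | zero =>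
    obtain ⟨y, rfl⟩ := e1.surjective x
    simp only [he1F, he1V, FV_eq, VF_eq, map_smul, and_self]
  | succ k =>
    obtain ⟨_, h1, h2, _⟩ := hbox k
    exact ⟨LinearMap.congr_fun h1 x, LinearMap.congr_fun h2 x⟩

lemma VP_circ (P : ℕ → Type) [∀ j, AddCommGroup (P j)] [∀ j, Module ℤ_[p] (P j)]
    (FP VP : ∀ j, Module.End ℤ_[p] (P j))
    (e1 : (Fin n → ℤ_[p]) ≃ₗ[ℤ_[p]] P 1)
    (he1V : ∀ x, VP 1 (e1 x) = e1 (Vmap p n x))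
    (bβ : ∀ j, P (j + 1) →ₗ[ℤ_[p]] (Fin n → ℤ_[p]) →ₗ[ℤ_[p]] P (j + 2))
    (hbox : ∀ j, IsBoxtimes p (FP (j + 1)) (VP (j + 1)) (Fmap p n) (Vmap p n)
      (FP (j + 2)) (VP (j + 2)) (bβ j))
    (k : ℕ) (m : Fin (k + 1) → (Fin n → ℤ_[p])) :
    VP (k + 1) (circ P e1 bβ k m) = circ P e1 bβ k (Vmap p n ∘ m) := by
  induction k with
  | zero => exact he1V _
  | succ k ih =>
    simp only [circ]
    rw [(hbox k).1.2.2, ih, Fin.comp_init]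
    rfl

lemma FP_circ (P : ℕ → Type) [∀ j, AddCommGroup (P j)] [∀ j, Module ℤ_[p] (P j)]
    (FP VP : ∀ j, Module.End ℤ_[p] (P j))
    (e1 : (Fin n → ℤ_[p]) ≃ₗ[ℤ_[p]] P 1)
    (he1F : ∀ x, FP 1 (e1 x) = e1 (Fmap p n x))
    (he1V : ∀ x, VP 1 (e1 x) = e1 (Vmap p n x))
    (bβ : ∀ j, P (j + 1) →ₗ[ℤ_[p]] (Fin n → ℤ_[p]) →ₗ[ℤ_[p]] P (j + 2))
    (hbox : ∀ j, IsBoxtimes p (FP (j + 1)) (VP (j + 1)) (Fmap p n) (Vmap p n)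
      (FP (j + 2)) (VP (j + 2)) (bβ j))
    (k : ℕ) (m : Fin (k + 1) → (Fin n → ℤ_[p])) (i : Fin (k + 1)) (x : (Fin n → ℤ_[p])) :
    FP (k + 1) (circ P e1 bβ k (Function.update (Vmap p n ∘ m) i x)) =
      circ P e1 bβ k (Function.update m i (Fmap p n x)) := by
  induction k with
  | zero =>
    have : i = 0 := Subsingleton.elim (α := Fin 1) _ _
    subst this
    simp only [circ, Function.update_self]
    exact he1F _
  | succ k ih =>
    simp only [circ]
    induction i using Fin.lastCases with
    | last =>
      rw [Fin.init_update_last, Fin.init_update_last, Function.update_self, Function.update_self,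
        ← Fin.comp_init, ← VP_circ P VP e1 he1V bβ (FP := FP) hbox, (hbox k).1.1]
    | cast i =>
      rw [Fin.init_update_castSucc, Fin.init_update_castSucc, ← ih,
        Function.update_of_ne (Fin.castSucc_lt_last i).ne',
        Function.update_of_ne (Fin.castSucc_lt_last i).ne', Function.comp_apply,
        (hbox k).1.2.1, Fin.comp_init]

/-- an `F`,`V`-stable submodule containing all the `β x m` is everything -/
lemma stable_top (P : ℕ → Type) [∀ j, AddCommGroup (P j)] [∀ j, Module ℤ_[p] (P j)]
    (FP VP : ∀ j, Module.End ℤ_[p] (P j))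
    (bβ : ∀ j, P (j + 1) →ₗ[ℤ_[p]] (Fin n → ℤ_[p]) →ₗ[ℤ_[p]] P (j + 2))
    (hbox : ∀ j, IsBoxtimes p (FP (j + 1)) (VP (j + 1)) (Fmap p n) (Vmap p n)
      (FP (j + 2)) (VP (j + 2)) (bβ j))
    (j : ℕ) (S : Submodule ℤ_[p] (P (j + 2)))
    (hF : ∀ x ∈ S, FP (j + 2) x ∈ S) (hV : ∀ x ∈ S, VP (j + 2) x ∈ S)
    (hb : ∀ x m, bβ j x m ∈ S) : S = ⊤ := by
  obtain ⟨hd, h1, h2, hu⟩ := hbox j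
  let FQ := S.mapQ S (FP (j + 2)) hF
  let VQ := S.mapQ S (VP (j + 2)) hV
  have hz := hu (P (j + 2) ⧸ S) FQ VQ (by
      apply Submodule.linearMap_qext
      ext x
      have := LinearMap.congr_fun h1 x
      simp only [Module.End.mul_apply] at this
      simp [FQ, VQ, this]) (by
      apply Submodule.linearMap_qext
      ext x
      have := LinearMap.congr_fun h2 x
      simp only [Module.End.mul_apply] at this
      simp [FQ, VQ, this]) 0 (by simp [IsDBilinear])
  have := hz.unique (y₁ := S.mkQ) (y₂ := 0) ⟨by ext x; simp [FQ], by ext x; simp [VQ], by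
    intro x m
    simpa using hb x m⟩ ⟨by simp, by simp, by simp⟩
  rw [← S.ker_mkQ, this, LinearMap.ker_zero]

lemma span_circ (P : ℕ → Type) [∀ j, AddCommGroup (P j)] [∀ j, Module ℤ_[p] (P j)]
    (FP VP : ∀ j, Module.End ℤ_[p] (P j))
    (e1 : (Fin n → ℤ_[p]) ≃ₗ[ℤ_[p]] P 1)
    (he1F : ∀ x, FP 1 (e1 x) = e1 (Fmap p n x))
    (he1V : ∀ x, VP 1 (e1 x) = e1 (Vmap p n x))
    (bβ : ∀ j, P (j + 1) →ₗ[ℤ_[p]] (Fin n → ℤ_[p]) →ₗ[ℤ_[p]] P (j + 2))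
    (hbox : ∀ j, IsBoxtimes p (FP (j + 1)) (VP (j + 1)) (Fmap p n) (Vmap p n)
      (FP (j + 2)) (VP (j + 2)) (bβ j))
    (j : ℕ) : Submodule.span ℤ_[p]
    {y : P (j + 1) | ∃ a m, y = (FP (j + 1) ^ a) (circ P e1 bβ j m)} = ⊤ := by
  induction j with
  | zero =>
    rw [eq_top_iff]
    intro x _
    apply Submodule.subset_span
    refine ⟨0, fun _ => e1.symm x, ?_⟩
    simp [circ]
  | succ j ih =>
    apply stable_top P FP VP bβ hbox
    · intro x hx
      induction hx using Submodule.span_induction with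
      | mem x hx =>
        obtain ⟨a, m, rfl⟩ := hx
        apply Submodule.subset_span
        exact ⟨a + 1, m, by rw [pow_succ']; rfl⟩
      | zero => simp
      | add x y _ _ hx hy => rw [map_add]; exact add_mem hx hy
      | smul c x _ hx => rw [map_smul]; exact Submodule.smul_mem _ _ hx
    · intro x hx
      induction hx using Submodule.span_induction with
      | mem x hx =>
        obtain ⟨a, m, rfl⟩ := hx
        cases a with
        | zero =>
          apply Submodule.subset_span
          refine ⟨0, Vmap p n ∘ m, ?_⟩
          simp only [pow_zero, Module.End.one_apply]
          exact VP_circ P FP VP e1 he1V bβ hbox _ _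
        | succ a =>
          rw [pow_succ', Module.End.mul_apply, (FVP P FP VP e1 he1F he1V bβ hbox _ _).2]
          exact Submodule.smul_mem _ _ (Submodule.subset_span ⟨a, m, rfl⟩)
      | zero => simp
      | add x y _ _ hx hy => rw [map_add]; exact add_mem hx hy
      | smul c x _ hx => rw [map_smul]; exact Submodule.smul_mem _ _ hx
    · intro x m
      have hx : x ∈ Submodule.span ℤ_[p]
        {y : P (j + 1) | ∃ a m, y = (FP (j + 1) ^ a) (circ P e1 bβ j m)} := by rw [ih]; trivial
      induction hx using Submodule.span_induction with
      | mem x hx =>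
        obtain ⟨a, v, rfl⟩ := hx
        apply Submodule.subset_span
        refine ⟨a, Fin.snoc v ((Vmap p n ^ a) m), ?_⟩
        simp only [circ, Fin.init_snoc, Fin.snoc_last]
        generalize circ P e1 bβ j v = y
        induction a generalizing m y with
        | zero => simp
        | succ a iha =>
          rw [pow_succ, Module.End.mul_apply, iha m (FP (j + 1) y), ← (hbox j).1.2.1,
            pow_succ, Module.End.mul_apply, pow_succ', Module.End.mul_apply]
      | zero => simp
      | add x y _ _ hx hy => rw [map_add, LinearMap.add_apply]; exact add_mem hx hy
      | smul c x _ hx =>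
        rw [map_smul, LinearMap.smul_apply]; exact Submodule.smul_mem _ _ hx

lemma exists_psi (P : ℕ → Type) [∀ j, AddCommGroup (P j)] [∀ j, Module ℤ_[p] (P j)]
    (FP VP : ∀ j, Module.End ℤ_[p] (P j))
    (e1 : (Fin n → ℤ_[p]) ≃ₗ[ℤ_[p]] P 1)
    (he1F : ∀ x, FP 1 (e1 x) = e1 (Fmap p n x))
    (he1V : ∀ x, VP 1 (e1 x) = e1 (Vmap p n x))
    (bβ : ∀ j, P (j + 1) →ₗ[ℤ_[p]] (Fin n → ℤ_[p]) →ₗ[ℤ_[p]] P (j + 2))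
    (hbox : ∀ j, IsBoxtimes p (FP (j + 1)) (VP (j + 1)) (Fmap p n) (Vmap p n)
      (FP (j + 2)) (VP (j + 2)) (bβ j))
    (j : ℕ) (G : ∀ q, Module.End ℤ_[p] (⋀[ℤ_[p]]^(q + 1) (Fin n → ℤ_[p])))
    (hG : ∀ q x, extPowMap (q + 1) (Vmap p n) (G q x) = (p : ℤ_[p]) • x) :
    ∃ ψ : P (j + 1) →ₗ[ℤ_[p]] ⋀[ℤ_[p]]^(j + 1) (Fin n → ℤ_[p]),
      (∀ x, ψ (FP (j + 1) x) = G j (ψ x)) ∧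
      (∀ x, ψ (VP (j + 1) x) = extPowMap (j + 1) (Vmap p n) (ψ x)) ∧
      (∀ m, ψ (circ P e1 bβ j m) = exteriorPower.ιMulti ℤ_[p] (j + 1) m) := by
  induction j with
  | zero =>
    let w : (Fin n → ℤ_[p]) →ₗ[ℤ_[p]] ⋀[ℤ_[p]]^1 (Fin n → ℤ_[p]) := (exteriorPower.oneEquiv ℤ_[p] (Fin n → ℤ_[p])).symm.toLinearMap
    have hw : ∀ x, w x = exteriorPower.ιMulti ℤ_[p] 1 (fun _ => x) := by
      intro x
      simp only [w, LinearEquiv.coe_coe]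
      rw [LinearEquiv.symm_apply_eq]
      simp
    have hwV : ∀ x, w (Vmap p n x) = extPowMap 1 (Vmap p n) (w x) := by
      intro x
      rw [hw, hw, extPowMap_ιMulti]
      rfl
    refine ⟨w ∘ₗ e1.symm.toLinearMap, ?_, ?_, ?_⟩
    · intro x
      obtain ⟨x, rfl⟩ := e1.surjective x
      apply extV_injective
      rw [hG]
      simp only [LinearMap.comp_apply, LinearEquiv.coe_coe, he1F,
        LinearEquiv.symm_apply_apply]
      rw [← hwV, VF_eq, map_smul]
    · intro x
      obtain ⟨x, rfl⟩ := e1.surjective x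
      simp only [LinearMap.comp_apply, LinearEquiv.coe_coe, he1V,
        LinearEquiv.symm_apply_apply]
      exact hwV x
    · intro m
      simp only [circ, LinearMap.comp_apply, LinearEquiv.coe_coe, LinearEquiv.symm_apply_apply]
      rw [hw]
      congr 1
      funext i
      congr 1
      exact Subsingleton.elim (α := Fin 1) _ _
  | succ j ih =>
    obtain ⟨ψ, hF, hV, hc⟩ := ih
    obtain ⟨hd, h1, h2, hu⟩ := hbox j
    obtain ⟨ψ', ⟨k1, k2, k3⟩, -⟩ := hu (⋀[ℤ_[p]]^(j + 2) (Fin n → ℤ_[p])) (G (j + 1))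
      (extPowMap (j + 2) (Vmap p n))
      (by
        refine LinearMap.ext fun x => ?_
        apply extV_injective
        simp only [Module.End.mul_apply, LinearMap.smul_apply, Module.End.one_apply]
        rw [hG, map_smul])
      (by
        refine LinearMap.ext fun x => ?_
        exact hG _ _)
      ((wedgeR (j + 1)) ∘ₗ ψ) (by
        refine ⟨fun x m => ?_, fun x m => ?_, fun x m => ?_⟩
        · apply extV_injective
          simp only [LinearMap.comp_apply]
          rw [hG, extV_wedgeR, VF_eq, map_smul, hV]
        · apply extV_injective
          simp only [LinearMap.comp_apply]
          rw [hG, extV_wedgeR, hF, hG, map_smul, LinearMap.smul_apply]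
        · simp only [LinearMap.comp_apply]
          rw [extV_wedgeR, hV])
    refine ⟨ψ', fun x => LinearMap.congr_fun k1 x, fun x => LinearMap.congr_fun k2 x, ?_⟩
    intro m
    simp only [circ]
    rw [k3, LinearMap.comp_apply, hc, wedgeR_ιMulti]

end chain

end helpers

theorem statement8 (p n k : ℕ) [Fact p.Prime] (hp : Odd p) (hq : k + 1 ≤ n)
    -- a chain of iterated bilinear products `P (j+1) = M^{⊠(j+1)}` for `M = ℤ_p^n`
    (P : ℕ → Type) [∀ j, AddCommGroup (P j)] [∀ j, Module ℤ_[p] (P j)]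
    (FP VP : ∀ j, Module.End ℤ_[p] (P j))
    (e1 : (Fin n → ℤ_[p]) ≃ₗ[ℤ_[p]] P 1)
    (he1F : ∀ x, FP 1 (e1 x) = e1 (Fmap p n x))
    (he1V : ∀ x, VP 1 (e1 x) = e1 (Vmap p n x))
    (bβ : ∀ j, P (j + 1) →ₗ[ℤ_[p]] (Fin n → ℤ_[p]) →ₗ[ℤ_[p]] P (j + 2))
    (hbox : ∀ j, IsBoxtimes p (FP (j + 1)) (VP (j + 1)) (Fmap p n) (Vmap p n)
      (FP (j + 2)) (VP (j + 2)) (bβ j))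
    -- the operator `F_q` on `Λ^q M`
    (Fq : Module.End ℤ_[p] (⋀[ℤ_[p]]^(k + 1) (Fin n → ℤ_[p])))
    (hFq : Fq * extPowMap (k + 1) (Vmap p n) =
      (p : ℤ_[p]) • (1 : Module.End ℤ_[p] (⋀[ℤ_[p]]^(k + 1) (Fin n → ℤ_[p])))) :
    -- `φ_q : Λ^q M → Λ^q_⊠ M = M^{⊠q}/(sign relations)`, wedges ↦ circle products,
    -- is an isomorphism of `R`-modules
    ∃ (φ : ⋀[ℤ_[p]]^(k + 1) (Fin n → ℤ_[p]) →ₗ[ℤ_[p]]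
        (P (k + 1) ⧸ signRel P FP VP e1 bβ k))
      (Fbar Vbar : Module.End ℤ_[p] (P (k + 1) ⧸ signRel P FP VP e1 bβ k)),
      -- `Fbar`, `Vbar` are the operators descended from `M^{⊠q}`
      (∀ x, Fbar (Submodule.Quotient.mk x) = Submodule.Quotient.mk (FP (k + 1) x)) ∧
      (∀ x, Vbar (Submodule.Quotient.mk x) = Submodule.Quotient.mk (VP (k + 1) x)) ∧
      -- `φ` sends wedges to circle products
      (∀ m : Fin (k + 1) → (Fin n → ℤ_[p]),
        φ ⟨ExteriorAlgebra.ιMulti ℤ_[p] (k + 1) m,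
            ExteriorAlgebra.ιMulti_range ℤ_[p] (k + 1) (Set.mem_range_self m)⟩ =
          Submodule.Quotient.mk (circ P e1 bβ k m)) ∧
      -- `φ` is `R`-linear ...
      (∀ x, φ (Fq x) = Fbar (φ x)) ∧
      (∀ x, φ (extPowMap (k + 1) (Vmap p n) x) = Vbar (φ x)) ∧
      -- ... and bijective
      Function.Bijective φ := by
  have hFV := FVP P FP VP e1 he1F he1V bβ hbox k
  set S := signRel P FP VP e1 bβ k with hS
  have hFS : S ≤ S.comap (FP (k + 1)) := by
    rw [hS, signRel, Submodule.span_le]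
    rintro _ ⟨a, b, σ, m, rfl⟩
    apply Submodule.subset_span
    exact ⟨a + 1, b, σ, m, by rw [pow_succ', mul_assoc]; rfl⟩
  have hcomm : Commute (VP (k + 1)) (FP (k + 1)) := by
    ext1 x
    simp only [Module.End.mul_apply]
    rw [(hFV x).1, (hFV x).2]
  have hVS : S ≤ S.comap (VP (k + 1)) := by
    rw [hS, signRel, Submodule.span_le]
    rintro _ ⟨a, b, σ, m, rfl⟩
    apply Submodule.subset_span
    refine ⟨a, b + 1, σ, m, ?_⟩
    rw [pow_succ', ← mul_assoc, ← (hcomm.pow_right a).eq, mul_assoc]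
    rfl
  let Fbar : Module.End ℤ_[p] (P (k + 1) ⧸ S) := S.mapQ S (FP (k + 1)) hFS
  let Vbar : Module.End ℤ_[p] (P (k + 1) ⧸ S) := S.mapQ S (VP (k + 1)) hVS
  have hFbar : ∀ x, Fbar (Submodule.Quotient.mk x) = Submodule.Quotient.mk (FP (k + 1) x) :=
    fun x => rfl
  have hVbar : ∀ x, Vbar (Submodule.Quotient.mk x) = Submodule.Quotient.mk (VP (k + 1) x) :=
    fun x => rfl
  have h2 : IsUnit (2 : ℤ_[p]) := by
    have : ((2 : ℕ) : ℤ_[p]) = 2 := by norm_num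
    rw [← this, PadicInt.isUnit_iff, PadicInt.norm_natCast_eq_one_iff]
    exact (Nat.coprime_two_right).2 hp
  let A : (Fin n → ℤ_[p]) [⋀^Fin (k + 1)]→ₗ[ℤ_[p]] (P (k + 1) ⧸ S) :=
    { S.mkQ.compMultilinearMap (circM P e1 bβ k) with
      map_eq_zero_of_eq' := by
        intro v i j hij hne
        show S.mkQ (circM P e1 bβ k v) = 0
        rw [circM_apply, Submodule.mkQ_apply, Submodule.Quotient.mk_eq_zero]
        have hm : circ P e1 bβ k (v ∘ Equiv.swap i j) -
            (Equiv.Perm.sign (Equiv.swap i j) : ℤ) • circ P e1 bβ k v ∈ S :=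
          Submodule.subset_span ⟨0, 0, Equiv.swap i j, v, by simp⟩
        have hv : v ∘ Equiv.swap i j = v := by
          funext l
          simp only [Function.comp_apply, Equiv.swap_apply_def]
          split_ifs with h h'
          · rw [h, hij]
          · rw [h', hij]
          · rfl
        rw [hv, Equiv.Perm.sign_swap hne] at hm
        have h3 : (2 : ℤ_[p]) • circ P e1 bβ k v ∈ S := by
          simpa [two_smul] using hm
        exact (Submodule.smul_mem_iff_of_isUnit S h2).1 h3 }
  have hA : ∀ m, A m = Submodule.Quotient.mk (circ P e1 bβ k m) := by
    intro m
    rw [← circM_apply]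
    rfl
  let φ := exteriorPower.alternatingMapLinearEquiv A
  have hφ : ∀ m, φ (exteriorPower.ιMulti ℤ_[p] (k + 1) m) =
      Submodule.Quotient.mk (circ P e1 bβ k m) := by
    intro m
    rw [← hA]
    exact exteriorPower.alternatingMapLinearEquiv_apply_ιMulti A m
  choose G hG using exists_Fq (p := p) (n := n)
  have hGF : ∀ x, Fq x = G k x := by
    intro x
    apply p_cancel
    have h := LinearMap.congr_fun hFq (G k x)
    simp only [Module.End.mul_apply, LinearMap.smul_apply, Module.End.one_apply] at h
    rw [hG, map_smul] at h
    exact h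
  have hφV : ∀ x, φ (extPowMap (k + 1) (Vmap p n) x) = Vbar (φ x) := by
    have : φ ∘ₗ extPowMap (k + 1) (Vmap p n) = Vbar ∘ₗ φ := by
      apply exteriorPower.linearMap_ext
      ext1 m
      simp only [LinearMap.compAlternatingMap_apply, LinearMap.comp_apply]
      rw [extPowMap_ιMulti, hφ, hφ, hVbar, VP_circ P FP VP e1 he1V bβ hbox]
    exact fun x => LinearMap.congr_fun this x
  have hφF : ∀ x, φ (Fq x) = Fbar (φ x) := by
    have : φ ∘ₗ Fq = Fbar ∘ₗ φ := by
      apply ext_update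
      intro m i x
      simp only [LinearMap.comp_apply]
      have h3 : Fq (exteriorPower.ιMulti ℤ_[p] (k + 1) (Function.update (Vmap p n ∘ m) i x)) =
          exteriorPower.ιMulti ℤ_[p] (k + 1) (Function.update m i (Fmap p n x)) := by
        apply extV_injective
        rw [hGF, hG, V_update]
      rw [h3, hφ, hφ, hFbar, FP_circ P FP VP e1 he1F he1V bβ hbox]
    exact fun x => LinearMap.congr_fun this x
  refine ⟨φ, Fbar, Vbar, hFbar, hVbar, hφ, hφF, hφV, ?_, ?_⟩
  · obtain ⟨ψ, hψF, hψV, hψc⟩ := exists_psi P FP VP e1 he1F he1V bβ hbox k G hG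
    have hψFa : ∀ a x, ψ ((FP (k + 1) ^ a) x) = (G k ^ a) (ψ x) := by
      intro a
      induction a with
      | zero => simp
      | succ a ih => intro x; rw [pow_succ', pow_succ', Module.End.mul_apply, hψF, ih]; rfl
    have hψVa : ∀ a x, ψ ((VP (k + 1) ^ a) x) =
        (extPowMap (k + 1) (Vmap p n) ^ a) (ψ x) := by
      intro a
      induction a with
      | zero => simp
      | succ a ih => intro x; rw [pow_succ', pow_succ', Module.End.mul_apply, hψV, ih]; rfl
    have hker : S ≤ LinearMap.ker ψ := by
      rw [hS, signRel, Submodule.span_le]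
      rintro _ ⟨a, b, σ, m, rfl⟩
      show ψ _ = 0
      rw [Module.End.mul_apply, hψFa, hψVa, map_sub, map_zsmul, hψc, hψc,
        AlternatingMap.map_perm]
      simp [Units.smul_def]
    have hinv : (S.liftQ ψ hker) ∘ₗ φ = LinearMap.id := by
      apply exteriorPower.linearMap_ext
      ext1 m
      simp only [LinearMap.compAlternatingMap_apply, LinearMap.comp_apply, LinearMap.id_apply]
      rw [hφ]
      exact hψc m
    exact Function.LeftInverse.injective (g := S.liftQ ψ hker)
      (fun x => LinearMap.congr_fun hinv x)
  · intro y
    obtain ⟨x, rfl⟩ := Submodule.Quotient.mk_surjective S y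
    have hx : x ∈ Submodule.span ℤ_[p]
        {y : P (k + 1) | ∃ a m, y = (FP (k + 1) ^ a) (circ P e1 bβ k m)} := by
      rw [span_circ P FP VP e1 he1F he1V bβ hbox]; trivial
    induction hx using Submodule.span_induction with
    | mem x hx =>
      obtain ⟨a, m, rfl⟩ := hx
      induction a with
      | zero => exact ⟨_, hφ m⟩
      | succ a ih =>
        obtain ⟨z, hz⟩ := ih
        refine ⟨Fq z, ?_⟩
        rw [hφF, hz, hFbar, pow_succ', Module.End.mul_apply]
    | zero => exact ⟨0, by simp⟩
    | add x y _ _ hx hy =>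
      obtain ⟨a, ha⟩ := hx
      obtain ⟨b, hb⟩ := hy
      exact ⟨a + b, by rw [map_add, ha, hb]; rfl⟩
    | smul c x _ hx =>
      obtain ⟨a, ha⟩ := hx
      exact ⟨c • a, by rw [map_smul, ha]; rfl⟩
end
end
end

section
/- Let M be an R-module that is free as a Z_p-module. For every q ≥ 1, the canonical Z_p-linear map Λ^q_{Z_p}(M) → Λ^q_⊠(M) sending m_1 ∧ ⋯ ∧ m_q to m_1 ∘ ⋯ ∘ m_q (well defined since p is odd, so m∘m = 0 in Λ^q_⊠(M)) is injective. -/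
set_option synthInstance.maxHeartbeats 1000000
set_option maxHeartbeats 1000000

/-! Statement 9: for a Dieudonné module `M` that is free as a `ℤ_p`-module and `q ≥ 1`
(written `q = k+1`), the canonical map `Λ^q_{ℤ_p}(M) → Λ^q_⊠(M)`,
`m₁ ∧ ⋯ ∧ m_q ↦ m₁ ∘ ⋯ ∘ m_q` (well defined since `p` is odd), is injective. -/

noncomputable section

/-- The circle product as a multilinear map. -/
def circMulti {p : ℕ} [Fact p.Prime] {M : Type} [AddCommGroup M] [Module ℤ_[p] M]
    (P : ℕ → Type) [∀ k, AddCommGroup (P k)] [∀ k, Module ℤ_[p] (P k)]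
    (e1 : M ≃ₗ[ℤ_[p]] P 1)
    (bβ : ∀ k, P (k + 1) →ₗ[ℤ_[p]] M →ₗ[ℤ_[p]] P (k + 2)) (k : ℕ) :
    MultilinearMap ℤ_[p] (fun _ : Fin (k + 1) => M) (P (k + 1)) :=
  MultilinearMap.mk' (circ P e1 bβ k)
    (by
      induction k with
      | zero => intro m i x y; fin_cases i; simp [circ]
      | succ k ih =>
        intro m i x y
        induction i using Fin.lastCases with
        | last => simp [circ]
        | cast i =>
          have h : ∀ z : M, Function.update m i.castSucc z (Fin.last (k + 1))
              = m (Fin.last (k + 1)) := fun z =>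
            Function.update_of_ne (Fin.castSucc_lt_last i).ne' _ _
          simp [circ, h, ih])
    (by
      induction k with
      | zero => intro m i x y; fin_cases i; simp [circ]
      | succ k ih =>
        intro m i x y
        induction i using Fin.lastCases with
        | last => simp [circ]
        | cast i =>
          have h : ∀ z : M, Function.update m i.castSucc z (Fin.last (k + 1))
              = m (Fin.last (k + 1)) := fun z =>
            Function.update_of_ne (Fin.castSucc_lt_last i).ne' _ _
          simp [circ, h, ih])

theorem circMulti_apply {p : ℕ} [Fact p.Prime] {M : Type} [AddCommGroup M] [Module ℤ_[p] M]
    (P : ℕ → Type) [∀ k, AddCommGroup (P k)] [∀ k, Module ℤ_[p] (P k)]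
    (e1 : M ≃ₗ[ℤ_[p]] P 1)
    (bβ : ∀ k, P (k + 1) →ₗ[ℤ_[p]] M →ₗ[ℤ_[p]] P (k + 2)) (k : ℕ) (m : Fin (k + 1) → M) :
    circMulti P e1 bβ k m = circ P e1 bβ k m := rfl

/-- The chain of comparison maps into an algebra `E` on which `V` acts by an algebra
automorphism with inverse `G`, and `F` acts as `p • G`. -/
theorem exists_chain {p : ℕ} [Fact p.Prime]
    {M : Type} [AddCommGroup M] [Module ℤ_[p] M]
    (FM VM : Module.End ℤ_[p] M)
    (P : ℕ → Type) [∀ j, AddCommGroup (P j)] [∀ j, Module ℤ_[p] (P j)]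
    (FP VP : ∀ j, Module.End ℤ_[p] (P j))
    (e1 : M ≃ₗ[ℤ_[p]] P 1)
    (he1F : ∀ x, FP 1 (e1 x) = e1 (FM x))
    (he1V : ∀ x, VP 1 (e1 x) = e1 (VM x))
    (bβ : ∀ j, P (j + 1) →ₗ[ℤ_[p]] M →ₗ[ℤ_[p]] P (j + 2))
    (hbox : ∀ j, IsBoxtimes p (FP (j + 1)) (VP (j + 1)) FM VM
      (FP (j + 2)) (VP (j + 2)) (bβ j))
    {E : Type} [Ring E] [Algebra ℤ_[p] E] (VE GE : E →ₐ[ℤ_[p]] E)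
    (hVG : ∀ x, VE (GE x) = x) (hGV : ∀ x, GE (VE x) = x)
    (f : M →ₗ[ℤ_[p]] E) (hfV : ∀ m, VE (f m) = f (VM m))
    (hfF : ∀ m, (p : ℤ_[p]) • GE (f m) = f (FM m)) (k : ℕ) :
    ∃ ψ : P (k + 1) →ₗ[ℤ_[p]] E,
      (∀ x, ψ (FP (k + 1) x) = (p : ℤ_[p]) • GE (ψ x)) ∧
      (∀ x, ψ (VP (k + 1) x) = VE (ψ x)) ∧
      ∀ m : Fin (k + 1) → M, ψ (circ P e1 bβ k m) = (List.ofFn fun i => f (m i)).prod := by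
  induction k with
  | zero =>
    refine ⟨f ∘ₗ e1.symm.toLinearMap, fun x => ?_, fun x => ?_, fun m => ?_⟩
    · obtain ⟨y, rfl⟩ := e1.surjective x
      simp [he1F, hfF]
    · obtain ⟨y, rfl⟩ := e1.surjective x
      simp [he1V, hfV]
    · simp [circ]
  | succ k ih =>
    obtain ⟨ψ, hF, hV, hc⟩ := ih
    obtain ⟨-, -, -, huniv⟩ := hbox k
    have key := huniv E ((p : ℤ_[p]) • GE.toLinearMap) VE.toLinearMap
      (by ext x; simp [hGV]) (by ext x; simp [hVG])
      ((LinearMap.mul ℤ_[p] E).compl₁₂ ψ f)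
      ⟨fun m n => by simp [hV, hGV, ← hfF],
       fun m n => by simp [hF, hGV, ← hfV],
       fun m n => by simp [hV, ← hfV]⟩
    obtain ⟨φ, ⟨h1, h2, h3⟩, -⟩ := key
    refine ⟨φ, fun x => ?_, fun x => ?_, fun m => ?_⟩
    · simpa using LinearMap.congr_fun h1 x
    · simpa using LinearMap.congr_fun h2 x
    · rw [circ, h3, List.ofFn_succ', List.concat_eq_append, List.prod_append]
      simp [hc, Fin.init]

/-- Injectivity of the map from the exterior power to the rational exterior algebra. -/
theorem injective_wedge {p : ℕ} [Fact p.Prime] {M : Type} [AddCommGroup M]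
    [Module ℤ_[p] M] [Module.Free ℤ_[p] M] (n : ℕ)
    (g : ⋀[ℤ_[p]]^n M →ₗ[ℤ_[p]] ExteriorAlgebra ℚ_[p] (TensorProduct ℤ_[p] ℚ_[p] M))
    (hg : ∀ m : Fin n → M, g (exteriorPower.ιMulti ℤ_[p] n m) =
      ExteriorAlgebra.ιMulti ℚ_[p] n (fun i => (1 : ℚ_[p]) ⊗ₜ[ℤ_[p]] m i)) :
    Function.Injective g := by
  classical
  let b := Module.Free.chooseBasis ℤ_[p] M
  let : LinearOrder (Module.Free.ChooseBasisIndex ℤ_[p] M) := linearOrderOfSTO WellOrderingRel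
  let bK := Algebra.TensorProduct.basis ℚ_[p] b
  have h1 := exteriorPower.ιMulti_family_linearIndependent_ofBasis ℚ_[p] n bK
  have h2 := h1.map' (Submodule.subtype _) (Submodule.ker_subtype _)
  have h3 : LinearIndependent ℤ_[p] (g ∘ b.exteriorPower n) := by
    have h4 := h2.restrict_scalars (R := ℤ_[p]) (by
      intro x y h
      exact Subtype.ext (by simpa [Algebra.smul_def] using h))
    have h7 : g ∘ b.exteriorPower n = (Submodule.subtype _) ∘
        exteriorPower.ιMulti_family ℚ_[p] n bK := by
      funext s
      simp only [Function.comp_apply, exteriorPower.basis_apply, exteriorPower.ιMulti_family, hg]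
      simp [bK, Function.comp_def]
    rw [h7]
    exact h4
  have h5 := h3
  rw [LinearIndependent, ← LinearMap.ker_eq_bot] at h5
  rw [← LinearMap.ker_eq_bot, LinearMap.ker_eq_bot']
  intro x hx
  have : Finsupp.linearCombination ℤ_[p] (g ∘ b.exteriorPower n) ((b.exteriorPower n).repr x) = 0 := by
    rw [← Finsupp.apply_linearCombination, Module.Basis.linearCombination_repr, hx]
  have h6 := (LinearMap.ker_eq_bot'.1 h5) _ this
  simpa using h6


theorem statement9 (p k : ℕ) [Fact p.Prime] (hp : Odd p)
    {M : Type} [AddCommGroup M] [Module ℤ_[p] M] [Module.Free ℤ_[p] M]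
    (FM VM : Module.End ℤ_[p] M)
    (hM : FM * VM = (p : ℤ_[p]) • (1 : Module.End ℤ_[p] M))
    (hM' : VM * FM = (p : ℤ_[p]) • (1 : Module.End ℤ_[p] M))
    -- a chain of iterated bilinear products `P (j+1) = M^{⊠(j+1)}`
    (P : ℕ → Type) [∀ j, AddCommGroup (P j)] [∀ j, Module ℤ_[p] (P j)]
    (FP VP : ∀ j, Module.End ℤ_[p] (P j))
    (e1 : M ≃ₗ[ℤ_[p]] P 1)
    (he1F : ∀ x, FP 1 (e1 x) = e1 (FM x))
    (he1V : ∀ x, VP 1 (e1 x) = e1 (VM x))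
    (bβ : ∀ j, P (j + 1) →ₗ[ℤ_[p]] M →ₗ[ℤ_[p]] P (j + 2))
    (hbox : ∀ j, IsBoxtimes p (FP (j + 1)) (VP (j + 1)) FM VM
      (FP (j + 2)) (VP (j + 2)) (bβ j)) :
    -- the canonical map `Λ^{k+1} M → Λ^{k+1}_⊠ M`, wedges ↦ circle products,
    -- exists (it is well defined since `p` is odd) ...
    (∃ φ : ⋀[ℤ_[p]]^(k + 1) M →ₗ[ℤ_[p]] (P (k + 1) ⧸ signRel P FP VP e1 bβ k),
      ∀ m : Fin (k + 1) → M,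
        φ ⟨ExteriorAlgebra.ιMulti ℤ_[p] (k + 1) m,
            ExteriorAlgebra.ιMulti_range ℤ_[p] (k + 1) (Set.mem_range_self m)⟩ =
          Submodule.Quotient.mk (circ P e1 bβ k m)) ∧
    -- ... and is injective
    (∀ φ : ⋀[ℤ_[p]]^(k + 1) M →ₗ[ℤ_[p]] (P (k + 1) ⧸ signRel P FP VP e1 bβ k),
      (∀ m : Fin (k + 1) → M,
        φ ⟨ExteriorAlgebra.ιMulti ℤ_[p] (k + 1) m,
            ExteriorAlgebra.ιMulti_range ℤ_[p] (k + 1) (Set.mem_range_self m)⟩ =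
          Submodule.Quotient.mk (circ P e1 bβ k m)) →
      Function.Injective φ) := by
  classical
  have h2u : IsUnit (2 : ℤ_[p]) := by
    rw [PadicInt.isUnit_iff]
    have : ¬ ((p : ℤ) ∣ 2) := by
      intro h
      have h' : p ∣ 2 := by exact_mod_cast h
      have := (Nat.prime_dvd_prime_iff_eq (Fact.out : p.Prime) Nat.prime_two).1 h'
      subst this
      exact absurd hp (by decide)
    have h3 := (PadicInt.norm_int_lt_one_iff_dvd (p := p) 2).not.2 this
    exact le_antisymm (PadicInt.norm_le_one _) (by simpa using h3)
  refine ⟨?_, ?_⟩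
  · let A : M [⋀^Fin (k + 1)]→ₗ[ℤ_[p]] (P (k + 1) ⧸ signRel P FP VP e1 bβ k) :=
      { (signRel P FP VP e1 bβ k).mkQ.compMultilinearMap (circMulti P e1 bβ k) with
        map_eq_zero_of_eq' := by
          intro m i j hij hne
          change (signRel P FP VP e1 bβ k).mkQ (circ P e1 bβ k m) = 0
          rw [Submodule.mkQ_apply, Submodule.Quotient.mk_eq_zero]
          have hm : m ∘ Equiv.swap i j = m := by
            funext l
            simp only [Function.comp_apply, Equiv.swap_apply_def]
            split_ifs with h h' <;> simp_all
          have : (2 : ℤ_[p]) • circ P e1 bβ k m ∈ signRel P FP VP e1 bβ k := by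
            refine Submodule.subset_span ⟨0, 0, Equiv.swap i j, m, ?_⟩
            simp [hm, Equiv.Perm.sign_swap hne, two_smul]
          exact (Submodule.smul_mem_iff_of_isUnit _ h2u).1 this }
    refine ⟨exteriorPower.alternatingMapLinearEquiv A, fun m => ?_⟩
    exact exteriorPower.alternatingMapLinearEquiv_apply_ιMulti A m
  · intro φ hφ
    have hp0 : (p : ℚ_[p]) ≠ 0 := by exact_mod_cast (Fact.out : p.Prime).ne_zero
    let N := TensorProduct ℤ_[p] ℚ_[p] M
    let VK : N →ₗ[ℚ_[p]] N := VM.baseChange ℚ_[p]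
    let FK : N →ₗ[ℚ_[p]] N := FM.baseChange ℚ_[p]
    let GK : N →ₗ[ℚ_[p]] N := (p : ℚ_[p])⁻¹ • FK
    have hFV : FK ∘ₗ VK = (p : ℚ_[p]) • LinearMap.id := by
      have : FM ∘ₗ VM = (p : ℤ_[p]) • LinearMap.id := hM
      rw [← LinearMap.baseChange_comp, this, LinearMap.baseChange_smul]
      ext x
      simp [TensorProduct.smul_tmul', Algebra.smul_def]
    have hVF : VK ∘ₗ FK = (p : ℚ_[p]) • LinearMap.id := by
      have : VM ∘ₗ FM = (p : ℤ_[p]) • LinearMap.id := hM'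
      rw [← LinearMap.baseChange_comp, this, LinearMap.baseChange_smul]
      ext x
      simp [TensorProduct.smul_tmul', Algebra.smul_def]
    have hGV : GK ∘ₗ VK = LinearMap.id := by
      rw [LinearMap.smul_comp, hFV, smul_smul, inv_mul_cancel₀ hp0, one_smul]
    have hVG : VK ∘ₗ GK = LinearMap.id := by
      rw [LinearMap.comp_smul, hVF, smul_smul, inv_mul_cancel₀ hp0, one_smul]
    let E := ExteriorAlgebra ℚ_[p] N
    let VE : E →ₐ[ℤ_[p]] E := (ExteriorAlgebra.map VK).restrictScalars ℤ_[p]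
    let GE : E →ₐ[ℤ_[p]] E := (ExteriorAlgebra.map GK).restrictScalars ℤ_[p]
    let f : M →ₗ[ℤ_[p]] E := ((ExteriorAlgebra.ι ℚ_[p]).restrictScalars ℤ_[p]) ∘ₗ
      (TensorProduct.mk ℤ_[p] ℚ_[p] M 1)
    have hf : ∀ m, f m = ExteriorAlgebra.ι ℚ_[p] ((1 : ℚ_[p]) ⊗ₜ[ℤ_[p]] m) := fun _ => rfl
    have hVE : ∀ x, VE x = ExteriorAlgebra.map VK x := fun _ => rfl
    have hGE : ∀ x, GE x = ExteriorAlgebra.map GK x := fun _ => rfl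
    obtain ⟨ψ, hF, hV, hc⟩ := exists_chain FM VM P FP VP e1 he1F he1V bβ hbox VE GE
      (fun x => by
        rw [hVE, hGE, ← AlgHom.comp_apply, ExteriorAlgebra.map_comp_map, hVG,
          ExteriorAlgebra.map_id]; rfl)
      (fun x => by
        rw [hVE, hGE, ← AlgHom.comp_apply, ExteriorAlgebra.map_comp_map, hGV,
          ExteriorAlgebra.map_id]; rfl)
      f
      (fun m => by
        rw [hVE, hf, hf, ExteriorAlgebra.map_apply_ι]; rfl)
      (fun m => by
        rw [hGE, hf, hf, ExteriorAlgebra.map_apply_ι]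
        have : GK ((1 : ℚ_[p]) ⊗ₜ[ℤ_[p]] m) = (p : ℚ_[p])⁻¹ • ((1 : ℚ_[p]) ⊗ₜ[ℤ_[p]] FM m) := rfl
        rw [this, map_smul, ← algebraMap_smul ℚ_[p] (p : ℤ_[p]), smul_smul]
        simp [hp0]) k
    have hle : signRel P FP VP e1 bβ k ≤ LinearMap.ker ψ := by
      refine Submodule.span_le.2 ?_
      rintro x ⟨a, c, σ, m, rfl⟩
      have h0 : ψ (circ P e1 bβ k (m ∘ σ) - (Equiv.Perm.sign σ : ℤ) • circ P e1 bβ k m) = 0 := by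
        rw [map_sub, map_zsmul, hc, hc]
        have := (ExteriorAlgebra.ιMulti ℚ_[p] (k + 1)).map_perm
          (fun i => (1 : ℚ_[p]) ⊗ₜ[ℤ_[p]] m i) σ
        rw [ExteriorAlgebra.ιMulti_apply, ExteriorAlgebra.ιMulti_apply] at this
        rw [sub_eq_zero]
        exact this
      have hVc : ∀ (c : ℕ) (y), ψ y = 0 → ψ ((VP (k + 1) ^ c) y) = 0 := by
        intro c
        induction c with
        | zero => intro y hy; simpa using hy
        | succ c ih => intro y hy; rw [pow_succ]; exact ih _ (by rw [hV, hy, map_zero])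
      have hFc : ∀ (c : ℕ) (y), ψ y = 0 → ψ ((FP (k + 1) ^ c) y) = 0 := by
        intro c
        induction c with
        | zero => intro y hy; simpa using hy
        | succ c ih =>
          intro y hy; rw [pow_succ]; exact ih _ (by rw [hF, hy, map_zero, smul_zero])
      exact hFc a _ (hVc c _ h0)
    have hinj := injective_wedge (k + 1) (((signRel P FP VP e1 bβ k).liftQ ψ hle) ∘ₗ φ)
      (fun m => by
        have := hφ m
        rw [LinearMap.comp_apply, ExteriorAlgebra.ιMulti_apply]
        erw [this]
        rw [Submodule.liftQ_apply, hc]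
        rfl)
    rw [LinearMap.coe_comp] at hinj
    exact hinj.of_comp
end
end
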